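/- arXiv:nlin/0609016 — 5 statements merged into one kernel-verified Lean document; each statement's English description precedes it below -/
import Mathlib

section
/- For every pair of bounded real sequences (a₀, b₀) ∈ ℓ∞(ℤ,ℝ) ⊕ ℓ∞(ℤ,ℝ) there exists a unique integral curve t ↦ (a(t), b(t)) of the r-th Toda lattice equation TL_r, defined for all t ∈ ℝ, which is infinitely differentiable as a map from ℝ into the Banach space ℓ∞(ℤ,ℝ) ⊕ ℓ∞(ℤ,ℝ) and satisfies (a(0), b(0)) = (a₀, b₀). -/
noncomputable section
open scoped ENNReal

/-- `ℓ²(ℤ,ℝ)`. -/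
abbrev L2Z := lp (fun _ : ℤ => ℝ) 2

/-- `ℓ∞(ℤ,ℝ)`. -/
abbrev LinfZ := lp (fun _ : ℤ => ℝ) ∞

/-- The standard orthonormal basis vector `δ_n` of `ℓ²(ℤ)`. -/
def deltaBasis (n : ℤ) : L2Z := lp.single 2 n 1

/-- `H` is the Jacobi operator associated with the bounded sequences `a, b`, i.e.
`(H f)(n) = a n * f (n+1) + a (n-1) * f (n-1) + b n * f n`. -/
def IsJacobiOp (a b : ℤ → ℝ) (H : L2Z →L[ℝ] L2Z) : Prop :=
  ∀ (f : L2Z) (n : ℤ), H f n = a n * f (n + 1) + a (n - 1) * f (n - 1) + b n * f n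

/-- `g_j(n) = ∑_{ℓ=0}^j c_{j-ℓ} ⟨δ_n, H^ℓ δ_n⟩`. -/
def gCoeff (c : ℕ → ℝ) (H : L2Z →L[ℝ] L2Z) (j : ℕ) (n : ℤ) : ℝ :=
  ∑ l ∈ Finset.range (j + 1), c (j - l) * inner (𝕜 := ℝ) (deltaBasis n) ((H ^ l) (deltaBasis n))

/-- `h_j(n) = 2 a n ∑_{ℓ=0}^j c_{j-ℓ} ⟨δ_{n+1}, H^ℓ δ_n⟩ + c_{j+1}`. -/
def hCoeff (a : ℤ → ℝ) (c : ℕ → ℝ) (H : L2Z →L[ℝ] L2Z) (j : ℕ) (n : ℤ) : ℝ :=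
  2 * a n * ∑ l ∈ Finset.range (j + 1),
      c (j - l) * inner (𝕜 := ℝ) (deltaBasis (n + 1)) ((H ^ l) (deltaBasis n)) + c (j + 1)

/-- A curve `t ↦ (a(t), b(t))` in `ℓ∞(ℤ,ℝ) ⊕ ℓ∞(ℤ,ℝ)` solves the `r`-th Toda lattice
equation `TL_r` (with summation constants `c`): for all `n` and `t`,
`ȧ(n,t) = a(n,t) (g_{r+1}(n+1,t) - g_{r+1}(n,t))` and
`ḃ(n,t) = h_{r+1}(n,t) - h_{r+1}(n-1,t)`, where `g_{r+1}, h_{r+1}` are computed from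
the Jacobi operator `H(a(t), b(t))`. -/
def IsTodaSolution (r : ℕ) (c : ℕ → ℝ) (u : ℝ → LinfZ × LinfZ) : Prop :=
  ∀ t : ℝ, ∃ H : L2Z →L[ℝ] L2Z,
    IsJacobiOp (fun n => (u t).1 n) (fun n => (u t).2 n) H ∧
    ∀ n : ℤ,
      HasDerivAt (fun s : ℝ => (u s).1 n)
        ((u t).1 n * (gCoeff c H (r + 1) (n + 1) - gCoeff c H (r + 1) n)) t ∧
      HasDerivAt (fun s : ℝ => (u s).2 n)
        (hCoeff (fun m => (u t).1 m) c H (r + 1) n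
          - hCoeff (fun m => (u t).1 m) c H (r + 1) (n - 1)) t

/-! ### Operators on `ℓ²(ℤ)` given by a single diagonal -/

theorem memℓp_mul_shift (a : LinfZ) (k : ℤ) (f : L2Z) :
    Memℓp (fun n : ℤ => a n * f (n + k)) 2 := by
  have hf : Summable fun n : ℤ => ‖f n‖ ^ (2 : ℝ≥0∞).toReal :=
    (lp.memℓp f).summable (by norm_num)
  have hf' : Summable fun n : ℤ => ‖f (n + k)‖ ^ (2 : ℝ≥0∞).toReal :=
    (Equiv.addRight k).summable_iff.2 hf
  refine memℓp_gen (Summable.of_nonneg_of_le (fun n => by positivity) (fun n => ?_)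
    (hf'.mul_left (‖a‖ ^ (2 : ℝ≥0∞).toReal)))
  rw [norm_mul, Real.mul_rpow (norm_nonneg _) (norm_nonneg _)]
  gcongr
  exact lp.norm_apply_le_norm (by simp) a n

/-- The sequence `n ↦ a n * f (n + k)` as an element of `ℓ²(ℤ)`. -/
def mulShift (a : LinfZ) (k : ℤ) (f : L2Z) : L2Z := ⟨_, memℓp_mul_shift a k f⟩

theorem mulShift_apply (a : LinfZ) (k : ℤ) (f : L2Z) (n : ℤ) :
    mulShift a k f n = a n * f (n + k) := rfl

theorem norm_mulShift_le (a : LinfZ) (k : ℤ) (f : L2Z) : ‖mulShift a k f‖ ≤ ‖a‖ * ‖f‖ := by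
  have h2 : 0 < (2 : ℝ≥0∞).toReal := by norm_num
  have hf' : HasSum (fun n : ℤ => ‖f (n + k)‖ ^ (2 : ℝ≥0∞).toReal)
      (‖f‖ ^ (2 : ℝ≥0∞).toReal) :=
    (Equiv.addRight k).hasSum_iff.2 (lp.hasSum_norm h2 f)
  refine lp.norm_le_of_tsum_le h2 (by positivity) ?_
  rw [Real.mul_rpow (norm_nonneg _) (norm_nonneg _)]
  refine hasSum_le (fun n => ?_) ((lp.memℓp (mulShift a k f)).summable h2).hasSum
    (hf'.mul_left _)
  rw [mulShift_apply, norm_mul, Real.mul_rpow (norm_nonneg _) (norm_nonneg _)]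
  gcongr
  exact lp.norm_apply_le_norm (by simp) a n

/-- The operator `(diagOp k a f)(n) = a n * f (n + k)` on `ℓ²(ℤ)`. -/
def diagOp (k : ℤ) : LinfZ →L[ℝ] L2Z →L[ℝ] L2Z :=
  LinearMap.mkContinuous₂
    (LinearMap.mk₂ ℝ (fun a f => mulShift a k f)
      (fun a a' f => lp.ext <| funext fun n => by
        simp [mulShift_apply, add_mul])
      (fun s a f => lp.ext <| funext fun n => by
        simp [mulShift_apply, mul_assoc])
      (fun a f f' => lp.ext <| funext fun n => by
        simp [mulShift_apply, mul_add])
      (fun s a f => lp.ext <| funext fun n => by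
        simp [mulShift_apply, mul_left_comm]))
    1 (fun a f => by simpa using norm_mulShift_le a k f)

theorem diagOp_apply (k : ℤ) (a : LinfZ) (f : L2Z) (n : ℤ) :
    diagOp k a f n = a n * f (n + k) := rfl

/-- The shift `(shift k a)(n) = a (n + k)` on `ℓ∞(ℤ)`. -/
def shift (k : ℤ) : LinfZ →L[ℝ] LinfZ :=
  LinearMap.mkContinuous
    { toFun := fun a => ⟨fun n => a (n + k), memℓp_infty
        ⟨‖a‖, by rintro _ ⟨n, rfl⟩; exact lp.norm_apply_le_norm (by simp) a (n + k)⟩⟩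
      map_add' := fun _ _ => rfl
      map_smul' := fun _ _ => rfl }
    1 (fun a => lp.norm_le_of_forall_le (by positivity) fun n =>
      (lp.norm_apply_le_norm (by simp) a (n + k)).trans_eq (one_mul _).symm)

/-- Evaluation of a bounded sequence as a continuous linear functional. -/
def evalLinf (n : ℤ) : LinfZ →L[ℝ] ℝ :=
  LinearMap.mkContinuous
    { toFun := fun a => a n
      map_add' := fun _ _ => rfl
      map_smul' := fun _ _ => rfl }
    1 (fun a => (lp.norm_apply_le_norm (by simp) a n).trans_eq (one_mul _).symm)

theorem deltaBasis_apply (m n : ℤ) : deltaBasis m n = if n = m then 1 else 0 := by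
  simp [deltaBasis, Pi.single_apply]

theorem norm_deltaBasis (n : ℤ) : ‖deltaBasis n‖ = 1 := by
  simp [deltaBasis, lp.norm_single]

theorem inner_deltaBasis_left (n : ℤ) (f : L2Z) :
    inner (𝕜 := ℝ) (deltaBasis n) f = f n := by
  simp [deltaBasis, lp.inner_single_left]

theorem abs_entry_le (T : L2Z →L[ℝ] L2Z) (i j : ℤ) : |T (deltaBasis j) i| ≤ ‖T‖ := by
  have h := lp.norm_apply_le_norm (by simp) (T (deltaBasis j)) i
  have h' := T.le_opNorm (deltaBasis j)
  rw [norm_deltaBasis, mul_one] at h'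
  exact h.trans h'

theorem ext_entry {S T : L2Z →L[ℝ] L2Z}
    (h : ∀ i j, S (deltaBasis j) i = T (deltaBasis j) i) : S = T := by
  refine lp.ext_continuousLinearMap (by simp) fun j => ?_
  ext i
  exact h i j

theorem adjoint_entry (T : L2Z →L[ℝ] L2Z) (i j : ℤ) :
    (ContinuousLinearMap.adjoint T) (deltaBasis j) i = T (deltaBasis i) j := by
  rw [← inner_deltaBasis_left, ContinuousLinearMap.adjoint_inner_right, real_inner_comm,
    inner_deltaBasis_left]

/-- The `k`-th diagonal of a bounded operator, `(diagonal k T)(n) = ⟨δ_n, T δ_{n+k}⟩`. -/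
def diagonal (k : ℤ) : (L2Z →L[ℝ] L2Z) →L[ℝ] LinfZ :=
  LinearMap.mkContinuous
    { toFun := fun T => ⟨fun n => T (deltaBasis (n + k)) n, memℓp_infty
        ⟨‖T‖, by rintro _ ⟨n, rfl⟩; exact abs_entry_le T n (n + k)⟩⟩
      map_add' := fun _ _ => rfl
      map_smul' := fun _ _ => rfl }
    1 (fun T => lp.norm_le_of_forall_le (by positivity) fun n =>
      (abs_entry_le T n (n + k)).trans_eq (one_mul _).symm)

theorem diagonal_apply (k : ℤ) (T : L2Z →L[ℝ] L2Z) (n : ℤ) :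
    diagonal k T n = T (deltaBasis (n + k)) n := rfl

/-! ### Jacobi operators -/

/-- The Jacobi operator `H(a,b)`, depending linearly on `(a,b)`. -/
def jacobi : LinfZ × LinfZ →L[ℝ] L2Z →L[ℝ] L2Z :=
  (diagOp 1 + (diagOp (-1)).comp (shift (-1))).comp (ContinuousLinearMap.fst ℝ LinfZ LinfZ)
    + (diagOp 0).comp (ContinuousLinearMap.snd ℝ LinfZ LinfZ)

theorem jacobi_apply (u : LinfZ × LinfZ) (f : L2Z) (n : ℤ) :
    jacobi u f n = u.1 n * f (n + 1) + u.1 (n - 1) * f (n - 1) + u.2 n * f n := by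
  change u.1 n * f (n + 1) + u.1 (n + -1) * f (n + -1) + u.2 n * f (n + 0) = _
  rw [add_zero, ← sub_eq_add_neg]

theorem isJacobiOp_iff (u : LinfZ × LinfZ) (H : L2Z →L[ℝ] L2Z) :
    IsJacobiOp (fun n => u.1 n) (fun n => u.2 n) H ↔ H = jacobi u := by
  constructor
  · intro h
    ext f n
    rw [h f n, jacobi_apply]
  · rintro rfl f n
    exact jacobi_apply u f n

theorem jacobi_deltaBasis (u : LinfZ × LinfZ) (j : ℤ) :
    jacobi u (deltaBasis j) = u.1 (j - 1) • deltaBasis (j - 1) + u.2 j • deltaBasis j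
      + u.1 j • deltaBasis (j + 1) := by
  ext n
  rw [jacobi_apply]
  simp only [lp.coeFn_add, lp.coeFn_smul, Pi.add_apply, Pi.smul_apply, smul_eq_mul,
    deltaBasis_apply]
  rcases eq_or_ne n (j - 1) with rfl | h1
  · simp [show j - 1 ≠ j + 1 by omega, show j - 1 - 1 ≠ j by omega]
  rcases eq_or_ne n j with rfl | h2
  · simp [show n ≠ n - 1 by omega]
  rcases eq_or_ne n (j + 1) with rfl | h3
  · simp [show j + 1 + 1 ≠ j by omega, show j + 1 ≠ j - 1 by omega]
  grind

theorem norm_le_norm_jacobi (u : LinfZ × LinfZ) : ‖u‖ ≤ ‖jacobi u‖ := by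
  refine max_le ?_ ?_ <;> refine lp.norm_le_of_forall_le (norm_nonneg _) fun n => ?_
  · have h := abs_entry_le (jacobi u) n (n + 1)
    rw [jacobi_apply] at h
    simpa [deltaBasis_apply, show n - 1 ≠ n + 1 by omega] using h
  · have h := abs_entry_le (jacobi u) n n
    rw [jacobi_apply] at h
    simpa [deltaBasis_apply] using h

theorem isSelfAdjoint_jacobi (u : LinfZ × LinfZ) : IsSelfAdjoint (jacobi u) := by
  rw [ContinuousLinearMap.isSelfAdjoint_iff']
  refine ext_entry fun i j => ?_
  rw [adjoint_entry, jacobi_apply, jacobi_apply]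
  simp only [deltaBasis_apply]
  grind

theorem jacobi_pow_entry_eq_zero (u : LinfZ × LinfZ) (l : ℕ) (i j : ℤ) (h : j + l < i) :
    (jacobi u ^ l) (deltaBasis j) i = 0 := by
  induction l generalizing i with
  | zero => simp [deltaBasis_apply]; grind
  | succ l ih =>
    push_cast at h
    rw [pow_succ', mul_apply_eq_comp, jacobi_apply, ih _ (by omega),
      ih _ (by omega), ih _ (by omega)]
    ring

/-- Evaluation of a square-summable sequence as a continuous linear functional. -/
def evalL2 (n : ℤ) : L2Z →L[ℝ] ℝ := innerSL ℝ (deltaBasis n)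

theorem evalL2_apply (n : ℤ) (f : L2Z) : evalL2 n f = f n := inner_deltaBasis_left n f

/-! ### The Toda vector field and its Lax form -/

/-- The polynomial `∑_l c_{r+1-l} H^l` whose diagonals give `g_{r+1}` and `h_{r+1}`. -/
def todaPoly (r : ℕ) (c : ℕ → ℝ) (H : L2Z →L[ℝ] L2Z) : L2Z →L[ℝ] L2Z :=
  ∑ l ∈ Finset.range (r + 2), c (r + 1 - l) • H ^ l

/-- The sequence `n ↦ 2 a(n) ⟨δ_{n+1}, Q δ_n⟩`, where `Q = todaPoly r c (jacobi (a,b))`. -/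
def todaFlux (r : ℕ) (c : ℕ → ℝ) (u : LinfZ × LinfZ) : LinfZ :=
  (2 : ℝ) • (u.1 * shift 1 (diagonal (-1) (todaPoly r c (jacobi u))))

/-- The vector field of `TL_r` on `ℓ∞(ℤ) ⊕ ℓ∞(ℤ)`. -/
def todaField (r : ℕ) (c : ℕ → ℝ) (u : LinfZ × LinfZ) : LinfZ × LinfZ :=
  (u.1 * (shift 1 (diagonal 0 (todaPoly r c (jacobi u)))
      - diagonal 0 (todaPoly r c (jacobi u))),
    todaFlux r c u - shift (-1) (todaFlux r c u))

section Lax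

variable (r : ℕ) (c : ℕ → ℝ) (u : LinfZ × LinfZ)

theorem todaPoly_entry (H : L2Z →L[ℝ] L2Z) (f : L2Z) (i : ℤ) :
    todaPoly r c H f i = ∑ l ∈ Finset.range (r + 2), c (r + 1 - l) * (H ^ l) f i := by
  have h := map_sum (evalL2 i) (fun l => (c (r + 1 - l) • H ^ l) f) (Finset.range (r + 2))
  simp only [evalL2_apply] at h
  rw [todaPoly, sum_apply, h]
  rfl

theorem gCoeff_eq (H : L2Z →L[ℝ] L2Z) (n : ℤ) :
    gCoeff c H (r + 1) n = todaPoly r c H (deltaBasis n) n := by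
  simp only [gCoeff, todaPoly_entry, inner_deltaBasis_left]

theorem hCoeff_eq (a : ℤ → ℝ) (H : L2Z →L[ℝ] L2Z) (n : ℤ) :
    hCoeff a c H (r + 1) n
      = 2 * a n * todaPoly r c H (deltaBasis n) (n + 1) + c (r + 2) := by
  simp only [hCoeff, todaPoly_entry, inner_deltaBasis_left]

theorem todaField_fst_apply (n : ℤ) :
    (todaField r c u).1 n
      = u.1 n * (todaPoly r c (jacobi u) (deltaBasis (n + 1)) (n + 1)
          - todaPoly r c (jacobi u) (deltaBasis n) n) := by
  change u.1 n * (todaPoly r c (jacobi u) (deltaBasis (n + 1 + 0)) (n + 1)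
          - todaPoly r c (jacobi u) (deltaBasis (n + 0)) n) = _
  rw [add_zero, add_zero]

theorem todaField_snd_apply (n : ℤ) :
    (todaField r c u).2 n
      = 2 * (u.1 n * todaPoly r c (jacobi u) (deltaBasis n) (n + 1))
        - 2 * (u.1 (n - 1) * todaPoly r c (jacobi u) (deltaBasis (n - 1)) n) := by
  change 2 * (u.1 n * todaPoly r c (jacobi u) (deltaBasis (n + 1 + -1)) (n + 1))
        - 2 * (u.1 (n + -1) *
          todaPoly r c (jacobi u) (deltaBasis (n + -1 + 1 + -1)) (n + -1 + 1)) = _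
  rw [add_neg_cancel_right, neg_add_cancel_right, ← sub_eq_add_neg]

theorem todaPoly_symm (i j : ℤ) :
    todaPoly r c (jacobi u) (deltaBasis j) i = todaPoly r c (jacobi u) (deltaBasis i) j := by
  rw [todaPoly_entry, todaPoly_entry]
  refine Finset.sum_congr rfl fun l _ => ?_
  rw [← adjoint_entry (jacobi u ^ l),
    ContinuousLinearMap.isSelfAdjoint_iff'.1 ((isSelfAdjoint_jacobi u).pow l)]

theorem todaPoly_comm : Commute (todaPoly r c (jacobi u)) (jacobi u) :=
  Commute.sum_left _ _ _ fun l _ => ((Commute.refl _).pow_left l).smul_left _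

theorem todaPoly_entry_eq_zero (i j : ℤ) (h : j + (r + 1) < i) :
    todaPoly r c (jacobi u) (deltaBasis j) i = 0 := by
  rw [todaPoly_entry]
  refine Finset.sum_eq_zero fun l hl => ?_
  rw [Finset.mem_range] at hl
  rw [jacobi_pow_entry_eq_zero u l i j (by omega), mul_zero]

/-- The strictly lower triangular part of `todaPoly r c (jacobi u)`. -/
def lowerPart : L2Z →L[ℝ] L2Z :=
  ∑ k ∈ Finset.range (r + 1),
    diagOp (-(k + 1 : ℤ)) (diagonal (-(k + 1 : ℤ)) (todaPoly r c (jacobi u)))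

theorem lowerPart_entry (i j : ℤ) :
    lowerPart r c u (deltaBasis j) i
      = if j < i then todaPoly r c (jacobi u) (deltaBasis j) i else 0 := by
  have h := map_sum (evalL2 i) (fun k : ℕ => diagOp (-(k + 1 : ℤ))
    (diagonal (-(k + 1 : ℤ)) (todaPoly r c (jacobi u))) (deltaBasis j)) (Finset.range (r + 1))
  simp only [evalL2_apply, diagOp_apply, diagonal_apply, deltaBasis_apply] at h
  rw [lowerPart, sum_apply, h]
  split_ifs with hij
  · by_cases hr : j + (r + 1) < i
    · rw [todaPoly_entry_eq_zero r c u i j hr]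
      refine Finset.sum_eq_zero fun k hk => ?_
      rw [Finset.mem_range] at hk
      rw [if_neg (by omega), mul_zero]
    · rw [Finset.sum_eq_single_of_mem (i - j - 1).toNat (Finset.mem_range.2 (by omega))]
      · have : i + -(((i - j - 1).toNat : ℤ) + 1) = j := by omega
        rw [this, if_pos rfl, mul_one]
      · intro k _ hk
        rw [if_neg (by omega), mul_zero]
  · refine Finset.sum_eq_zero fun k hk => ?_
    rw [if_neg (by omega), mul_zero]

/-- The skew-adjoint operator of the Lax pair. -/
def laxOp : L2Z →L[ℝ] L2Z :=
  ContinuousLinearMap.adjoint (lowerPart r c u) - lowerPart r c u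

theorem inner_laxOp_self (x : L2Z) : inner (𝕜 := ℝ) x (laxOp r c u x) = 0 := by
  rw [laxOp, sub_apply, inner_sub_right,
    ContinuousLinearMap.adjoint_inner_right, real_inner_comm, sub_self]

theorem laxOp_entry (i j : ℤ) :
    laxOp r c u (deltaBasis j) i
      = if i < j then todaPoly r c (jacobi u) (deltaBasis j) i
        else if j < i then -todaPoly r c (jacobi u) (deltaBasis j) i else 0 := by
  change ContinuousLinearMap.adjoint (lowerPart r c u) (deltaBasis j) i
    - lowerPart r c u (deltaBasis j) i = _
  rw [adjoint_entry, lowerPart_entry, lowerPart_entry, todaPoly_symm r c u j i]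
  rcases lt_trichotomy i j with h | h | h
  · simp [h, h.not_gt]
  · simp [h]
  · simp [h, h.not_gt]

theorem mul_jacobi_entry (T : L2Z →L[ℝ] L2Z) (i j : ℤ) :
    (T * jacobi u) (deltaBasis j) i = u.1 (j - 1) * T (deltaBasis (j - 1)) i
      + u.2 j * T (deltaBasis j) i + u.1 j * T (deltaBasis (j + 1)) i := by
  rw [mul_apply_eq_comp, jacobi_deltaBasis, map_add, map_add, map_smul, map_smul,
    map_smul]
  rfl

theorem jacobi_mul_entry (T : L2Z →L[ℝ] L2Z) (i j : ℤ) :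
    (jacobi u * T) (deltaBasis j) i = u.1 i * T (deltaBasis j) (i + 1)
      + u.1 (i - 1) * T (deltaBasis j) (i - 1) + u.2 i * T (deltaBasis j) i := by
  rw [mul_apply_eq_comp, jacobi_apply]

/-- The Lax representation of the Toda vector field. -/
theorem jacobi_todaField :
    jacobi (todaField r c u) = laxOp r c u * jacobi u - jacobi u * laxOp r c u := by
  refine ext_entry fun i j => ?_
  have hcomm : (todaPoly r c (jacobi u) * jacobi u) (deltaBasis j) i
      = (jacobi u * todaPoly r c (jacobi u)) (deltaBasis j) i := by
    rw [(todaPoly_comm r c u).eq]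
  change _ = (laxOp r c u * jacobi u) (deltaBasis j) i
    - (jacobi u * laxOp r c u) (deltaBasis j) i
  have hsymm := todaPoly_symm r c u
  rw [mul_jacobi_entry, jacobi_mul_entry] at hcomm
  rw [mul_jacobi_entry, jacobi_mul_entry, jacobi_apply, todaField_fst_apply,
    todaField_fst_apply, todaField_snd_apply]
  simp only [laxOp_entry, deltaBasis_apply]
  generalize todaPoly r c (jacobi u) = Q at *
  obtain h | rfl | rfl | rfl | h :
      i + 1 < j ∨ j = i + 1 ∨ j = i ∨ i = j + 1 ∨ j + 1 < i := by omega
  · have h1 : i + 1 ≠ j := by omega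
    have h2 : i - 1 ≠ j := by omega
    have h3 : i ≠ j := by omega
    have h4 : i < j - 1 := by omega
    have h5 : i < j := by omega
    have h6 : i < j + 1 := by omega
    have h7 : i - 1 < j := by omega
    simp only [h, h1, h2, h3, h4, h5, h6, h7, if_true, if_false]
    linarith
  · have h2 : i - 1 ≠ i + 1 := by omega
    have h6 : i < i + 1 + 1 := by omega
    have h7 : i - 1 < i + 1 := by omega
    simp [h2, h6, h7] at hcomm ⊢
    linarith
  · have h7 : j - 1 < j := by omega
    have h8 : j ≠ j - 1 := by omega
    have h9 : ¬ j < j - 1 := by omega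
    have h10 := hsymm j (j + 1)
    have h11 := hsymm j (j - 1)
    simp [h9] at hcomm ⊢
    rw [h10, ← h11]
    ring
  · have h1 : j - 1 < j + 1 := by omega
    have h2 : ¬ j + 1 < j - 1 := by omega
    have h3 : ¬ j + 1 + 1 < j := by omega
    have h4 : j + 1 + 1 ≠ j := by omega
    have h5 : j < j + 1 + 1 := by omega
    simp [h1, h2, h3, h4, h5] at hcomm ⊢
    linarith
  · have h1 : i + 1 ≠ j := by omega
    have h2 : i - 1 ≠ j := by omega
    have h3 : i ≠ j := by omega
    have h4 : ¬ i < j - 1 := by omega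
    have h5 : ¬ i < j := by omega
    have h6 : ¬ i < j + 1 := by omega
    have h7 : ¬ i - 1 < j := by omega
    have h8 : ¬ i + 1 < j := by omega
    have h9 : j - 1 < i := by omega
    have h10 : j < i := by omega
    have h11 : j < i - 1 := by omega
    have h12 : j < i + 1 := by omega
    simp only [h, h1, h2, h3, h4, h5, h6, h7, h8, h9, h10, h11, h12, if_true, if_false]
    linarith

end Lax

/-! ### Norm bounds for Lax equations -/

section LaxNorm

open Filter Topology Set

variable {V : Type*} [NormedAddCommGroup V] [InnerProductSpace ℝ V]

theorem norm_one_add_smul_sq_le {P : V →L[ℝ] V} (hP : ∀ x, inner (𝕜 := ℝ) x (P x) = 0) (s : ℝ) :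
    ‖(1 : V →L[ℝ] V) + s • P‖ ^ 2 ≤ 1 + s ^ 2 * ‖P‖ ^ 2 := by
  have hle : ‖(1 : V →L[ℝ] V) + s • P‖ ≤ √(1 + s ^ 2 * ‖P‖ ^ 2) := by
    refine ContinuousLinearMap.opNorm_le_bound _ (Real.sqrt_nonneg _) fun x => ?_
    refine le_of_sq_le_sq ?_ (by positivity)
    change ‖x + s • P x‖ ^ 2 ≤ _
    rw [norm_add_sq_real, inner_smul_right, hP, mul_pow, Real.sq_sqrt (by positivity),
      norm_smul, mul_pow, Real.norm_eq_abs, sq_abs]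
    have h := pow_le_pow_left₀ (norm_nonneg _) (P.le_opNorm x) 2
    rw [mul_pow] at h
    nlinarith [mul_le_mul_of_nonneg_left h (sq_nonneg s)]
  calc _ ≤ √(1 + s ^ 2 * ‖P‖ ^ 2) ^ 2 := by gcongr
    _ = _ := Real.sq_sqrt (by positivity)

theorem norm_conj_le {P : V →L[ℝ] V} (hP : ∀ x, inner (𝕜 := ℝ) x (P x) = 0) (s : ℝ)
    (A : V →L[ℝ] V) :
    ‖(1 + s • P) * A * (1 + (-s) • P)‖ ≤ (1 + s ^ 2 * ‖P‖ ^ 2) * ‖A‖ := by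
  have h1 := norm_one_add_smul_sq_le hP s
  have h2 := norm_one_add_smul_sq_le hP (-s)
  rw [neg_sq] at h2
  calc _ ≤ ‖1 + s • P‖ * ‖A‖ * ‖1 + (-s) • P‖ :=
        (norm_mul_le _ _).trans (by gcongr; exact norm_mul_le _ _)
    _ = (‖1 + s • P‖ * ‖1 + (-s) • P‖) * ‖A‖ := by ring
    _ ≤ _ := by
      gcongr
      nlinarith [sq_nonneg (‖1 + s • P‖ - ‖1 + (-s) • P‖)]

theorem hasDerivAt_conj (P A : V →L[ℝ] V) (t : ℝ) :
    HasDerivAt (fun z : ℝ => (1 + (z - t) • P) * A * (1 + (-(z - t)) • P)) (P * A - A * P) t := by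
  have h0 : HasDerivAt (fun z : ℝ => z - t) 1 t := (hasDerivAt_id t).sub_const t
  have h1 : HasDerivAt (fun z : ℝ => 1 + (z - t) • P) ((1 : ℝ) • P) t :=
    (h0.smul_const P).const_add 1
  have h2 : HasDerivAt (fun z : ℝ => 1 + (-(z - t)) • P) ((-1 : ℝ) • P) t :=
    (h0.neg.smul_const P).const_add 1
  refine ((h1.mul_const A).mul h2).congr_deriv ?_
  simp [sub_eq_add_neg]

/-- The norm is nonincreasing along solutions of a Lax equation with skew-adjoint `P`. -/
theorem norm_le_of_lax_forward {A : ℝ → V →L[ℝ] V}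
    (hA : ∀ t, ∃ P : V →L[ℝ] V, (∀ x, inner (𝕜 := ℝ) x (P x) = 0) ∧
      HasDerivAt A (P * A t - A t * P) t) {T : ℝ} (hT : 0 ≤ T) : ‖A T‖ ≤ ‖A 0‖ := by
  have hcont : Continuous A := continuous_iff_continuousAt.2 fun t =>
    (hA t).choose_spec.2.continuousAt
  refine image_le_of_liminf_slope_right_le_deriv_boundary (f := fun t => ‖A t‖) (a := 0) (b := T)
    (B := fun _ => ‖A 0‖) (B' := fun _ => 0) hcont.norm.continuousOn le_rfl continuousOn_const
    (fun x _ => hasDerivWithinAt_const _ _ _) (fun t _ ρ hρ => ?_) (right_mem_Icc.2 hT)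
  obtain ⟨P, hP, hd⟩ := hA t
  refine Eventually.frequently ?_
  have hφ := hd.sub (hasDerivAt_conj P (A t) t)
  rw [sub_self, hasDerivAt_iff_isLittleO] at hφ
  have hφ' := (hφ.def (half_pos hρ)).filter_mono (nhdsWithin_le_nhds (s := Ioi t))
  have hlim : Tendsto (fun z : ℝ => (z - t) * (‖P‖ ^ 2 * ‖A t‖)) (𝓝[>] t) (𝓝 0) := by
    have : ContinuousAt (fun z : ℝ => (z - t) * (‖P‖ ^ 2 * ‖A t‖)) t := by fun_prop
    simpa [ContinuousAt] using this.tendsto.mono_left (nhdsWithin_le_nhds (s := Ioi t))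
  filter_upwards [hφ', self_mem_nhdsWithin, hlim.eventually_lt_const (half_pos hρ)]
    with z hz hzt hz'
  have hzt' : 0 < z - t := sub_pos.2 hzt
  rw [slope_def_field, div_lt_iff₀ hzt']
  simp only [Pi.sub_apply, sub_self, zero_smul, neg_zero, add_zero, one_mul, mul_one, smul_zero,
    sub_zero, Real.norm_eq_abs, abs_of_pos hzt'] at hz
  have h1 := norm_le_norm_add_norm_sub' (A z) ((1 + (z - t) • P) * A t * (1 + (-(z - t)) • P))
  have h2 := norm_conj_le hP (z - t) (A t)
  nlinarith [mul_lt_mul_of_pos_right hz' hzt']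

theorem norm_le_of_lax {A : ℝ → V →L[ℝ] V}
    (hA : ∀ t, ∃ P : V →L[ℝ] V, (∀ x, inner (𝕜 := ℝ) x (P x) = 0) ∧
      HasDerivAt A (P * A t - A t * P) t) (T : ℝ) : ‖A T‖ ≤ ‖A 0‖ := by
  rcases le_total 0 T with hT | hT
  · exact norm_le_of_lax_forward hA hT
  · have hB : ∀ t, ∃ P : V →L[ℝ] V, (∀ x, inner (𝕜 := ℝ) x (P x) = 0) ∧
        HasDerivAt (fun t => A (-t)) (P * A (-t) - A (-t) * P) t := by
      intro t
      obtain ⟨P, hP, hd⟩ := hA (-t)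
      refine ⟨-P, fun x => by simp [hP], ?_⟩
      refine (hd.scomp t (hasDerivAt_neg t)).congr_deriv ?_
      simp only [neg_mul, mul_neg, neg_smul, one_smul]
      abel
    simpa using norm_le_of_lax_forward hB (neg_nonneg.2 hT)

end LaxNorm

/-! ### Maps that are Lipschitz on bounded sets -/

section LipschitzOnBounded

variable {E F G : Type*} [NormedAddCommGroup E] [NormedAddCommGroup F] [NormedAddCommGroup G]

/-- `f` is Lipschitz on every bounded set. -/
def LipschitzOnBounded (f : E → F) : Prop :=
  ∀ R : ℝ, ∃ K : ℝ, 0 ≤ K ∧ ∀ x y, ‖x‖ ≤ R → ‖y‖ ≤ R → ‖f x - f y‖ ≤ K * ‖x - y‖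

namespace LipschitzOnBounded

theorem exists_norm_le {f : E → F} (hf : LipschitzOnBounded f) (R : ℝ) :
    ∃ M : ℝ, 0 ≤ M ∧ ∀ x, ‖x‖ ≤ R → ‖f x‖ ≤ M := by
  obtain ⟨K, hK, h⟩ := hf R
  refine ⟨K * |R| + ‖f 0‖, by positivity, fun x hx => ?_⟩
  have h0 := h x 0 hx (by simpa using (norm_nonneg x).trans hx)
  rw [sub_zero] at h0
  have h1 : K * ‖x‖ ≤ K * |R| := by gcongr; exact hx.trans (le_abs_self R)
  linarith [norm_le_norm_sub_add (f x) (f 0)]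

theorem const (z : F) : LipschitzOnBounded (fun _ : E => z) :=
  fun _ => ⟨0, le_rfl, fun _ _ _ _ => by simp⟩

theorem add {f g : E → F} (hf : LipschitzOnBounded f) (hg : LipschitzOnBounded g) :
    LipschitzOnBounded (fun x => f x + g x) := fun R => by
  obtain ⟨K, hK, h⟩ := hf R
  obtain ⟨K', hK', h'⟩ := hg R
  refine ⟨K + K', by positivity, fun x y hx hy => ?_⟩
  rw [add_sub_add_comm, add_mul]
  exact (norm_add_le _ _).trans (add_le_add (h x y hx hy) (h' x y hx hy))

theorem sum {ι : Type*} (s : Finset ι) {f : ι → E → F} (hf : ∀ i, LipschitzOnBounded (f i)) :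
    LipschitzOnBounded (fun x => ∑ i ∈ s, f i x) := by
  classical
  induction s using Finset.induction_on with
  | empty => simpa using const (E := E) (0 : F)
  | insert i s hi ih => simpa [Finset.sum_insert hi] using (hf i).add ih

theorem mul {A : Type*} [NormedRing A] {f g : E → A} (hf : LipschitzOnBounded f)
    (hg : LipschitzOnBounded g) : LipschitzOnBounded (fun x => f x * g x) := fun R => by
  obtain ⟨K, hK, h⟩ := hf R
  obtain ⟨K', hK', h'⟩ := hg R
  obtain ⟨M, hM, hb⟩ := hf.exists_norm_le R
  obtain ⟨M', hM', hb'⟩ := hg.exists_norm_le R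
  refine ⟨M * K' + K * M', by positivity, fun x y hx hy => ?_⟩
  calc ‖f x * g x - f y * g y‖ = ‖f x * (g x - g y) + (f x - f y) * g y‖ := by
        congr 1; noncomm_ring
    _ ≤ ‖f x‖ * ‖g x - g y‖ + ‖f x - f y‖ * ‖g y‖ :=
        (norm_add_le _ _).trans (add_le_add (norm_mul_le _ _) (norm_mul_le _ _))
    _ ≤ M * (K' * ‖x - y‖) + (K * ‖x - y‖) * M' := by
        gcongr
        exacts [hb x hx, h' x y hx hy, h x y hx hy, hb' y hy]
    _ = _ := by ring

theorem pow {A : Type*} [NormedRing A] {f : E → A} (hf : LipschitzOnBounded f) (l : ℕ) :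
    LipschitzOnBounded (fun x => f x ^ l) := by
  induction l with
  | zero => simpa using const (E := E) (1 : A)
  | succ l ih => simpa only [pow_succ] using ih.mul hf

theorem prodMk {f : E → F} {g : E → G} (hf : LipschitzOnBounded f) (hg : LipschitzOnBounded g) :
    LipschitzOnBounded (fun x => (f x, g x)) := fun R => by
  obtain ⟨K, hK, h⟩ := hf R
  obtain ⟨K', hK', h'⟩ := hg R
  refine ⟨max K K', by positivity, fun x y hx hy => max_le ?_ ?_⟩
  · exact (h x y hx hy).trans (by gcongr; exact le_max_left _ _)
  · exact (h' x y hx hy).trans (by gcongr; exact le_max_right _ _)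

variable [NormedSpace ℝ F] [NormedSpace ℝ G]

theorem clm_comp (L : F →L[ℝ] G) {f : E → F} (hf : LipschitzOnBounded f) :
    LipschitzOnBounded (fun x => L (f x)) := fun R => by
  obtain ⟨K, hK, h⟩ := hf R
  refine ⟨‖L‖ * K, by positivity, fun x y hx hy => ?_⟩
  rw [← map_sub, mul_assoc]
  exact (L.le_opNorm _).trans (by gcongr; exact h x y hx hy)

theorem const_smul (s : ℝ) {f : E → F} (hf : LipschitzOnBounded f) :
    LipschitzOnBounded (fun x => s • f x) :=
  hf.clm_comp (s • ContinuousLinearMap.id ℝ F)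

theorem sub {f g : E → F} (hf : LipschitzOnBounded f) (hg : LipschitzOnBounded g) :
    LipschitzOnBounded (fun x => f x - g x) := by
  simpa [sub_eq_add_neg] using hf.add (hg.const_smul (-1))

theorem clm [NormedSpace ℝ E] (L : E →L[ℝ] F) : LipschitzOnBounded (fun x => L x) :=
  fun _ => ⟨‖L‖, norm_nonneg _, fun x y _ _ => by rw [← map_sub]; exact L.le_opNorm _⟩

end LipschitzOnBounded

end LipschitzOnBounded

/-! ### Global solutions of ordinary differential equations -/

section GlobalODE

open Set Filter Topology Metric NNReal

variable {E : Type*} [NormedAddCommGroup E]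

/-- The scaling factor of the radial retraction onto the closed ball of radius `R`. -/
def radialFactor (R : ℝ) (x : E) : ℝ := R / max R ‖x‖

theorem radialFactor_nonneg {R : ℝ} (hR : 0 < R) (x : E) : 0 ≤ radialFactor R x := by
  unfold radialFactor; positivity

theorem radialFactor_eq_one {R : ℝ} (hR : 0 < R) {x : E} (hx : ‖x‖ ≤ R) :
    radialFactor R x = 1 := by
  rw [radialFactor, max_eq_left hx, div_self hR.ne']

variable [NormedSpace ℝ E]

theorem norm_radialFactor_smul_le {R : ℝ} (hR : 0 < R) (x : E) :
    ‖radialFactor R x • x‖ ≤ R := by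
  have hm : 0 < max R ‖x‖ := lt_max_of_lt_left hR
  rw [norm_smul, Real.norm_of_nonneg (radialFactor_nonneg hR x), radialFactor, div_mul_eq_mul_div,
    div_le_iff₀ hm]
  gcongr
  exact le_max_right _ _

theorem norm_radialFactor_smul_sub_le {R : ℝ} (hR : 0 < R) (x y : E) :
    ‖radialFactor R x • x - radialFactor R y • y‖ ≤ 2 * ‖x - y‖ := by
  have hx : 0 < max R ‖x‖ := lt_max_of_lt_left hR
  have hy : 0 < max R ‖y‖ := lt_max_of_lt_left hR
  have h1 : radialFactor R x ≤ 1 := (div_le_one hx).2 (le_max_left _ _)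
  have h2 : |radialFactor R x - radialFactor R y| * ‖y‖ ≤ ‖x - y‖ := by
    have h3 : |max R ‖y‖ - max R ‖x‖| ≤ ‖x - y‖ := by
      rw [max_comm R, max_comm R]
      refine (abs_max_sub_max_le_abs ‖y‖ ‖x‖ R).trans ?_
      rw [norm_sub_rev]
      exact abs_norm_sub_norm_le y x
    have h4 : radialFactor R x - radialFactor R y
        = (max R ‖y‖ - max R ‖x‖) * (R / max R ‖x‖) / max R ‖y‖ := by
      unfold radialFactor
      field_simp
    rw [h4, abs_div, abs_mul, abs_of_pos hy, abs_of_nonneg (by positivity : 0 ≤ R / max R ‖x‖),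
      div_mul_eq_mul_div, div_le_iff₀ hy]
    calc |max R ‖y‖ - max R ‖x‖| * (R / max R ‖x‖) * ‖y‖ ≤ ‖x - y‖ * 1 * max R ‖y‖ := by
          gcongr
          exacts [h1, le_max_right _ _]
      _ = _ := by ring
  calc ‖radialFactor R x • x - radialFactor R y • y‖
      = ‖radialFactor R x • (x - y) + (radialFactor R x - radialFactor R y) • y‖ := by
        congr 1; module
    _ ≤ radialFactor R x * ‖x - y‖ + |radialFactor R x - radialFactor R y| * ‖y‖ := by
        refine (norm_add_le _ _).trans ?_
        rw [norm_smul, norm_smul, Real.norm_of_nonneg (radialFactor_nonneg hR x),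
          Real.norm_eq_abs]
    _ ≤ 1 * ‖x - y‖ + ‖x - y‖ := by gcongr
    _ = _ := by ring

theorem contDiff_of_hasDerivAt {v : E → E} (hv : ContDiff ℝ (⊤ : ℕ∞) v) {u : ℝ → E}
    (hu : ∀ t, HasDerivAt u (v (u t)) t) : ContDiff ℝ (⊤ : ℕ∞) u := by
  have hd : Differentiable ℝ u := fun t => (hu t).differentiableAt
  have hderiv : deriv u = v ∘ u := funext fun t => (hu t).deriv
  rw [contDiff_infty]
  intro n
  induction n with
  | zero => exact contDiff_zero.2 hd.continuous
  | succ n ih =>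
    push_cast
    rw [contDiff_succ_iff_deriv]
    refine ⟨hd, by simp, ?_⟩
    rw [hderiv]
    exact (hv.of_le (by exact_mod_cast le_top)).comp ih

variable [CompleteSpace E]

theorem exists_hasDerivAt_of_lipschitz_of_bounded {v : E → E} {K L : ℝ≥0}
    (hK : LipschitzWith K v) (hL : ∀ x, ‖v x‖ ≤ L) (x₀ : E) :
    ∃ u : ℝ → E, u 0 = x₀ ∧ ∀ t, HasDerivAt u (v (u t)) t := by
  have hloc : ∀ N : ℝ, ∃ u : ℝ → E, 0 < N →
      u 0 = x₀ ∧ ∀ t ∈ Ioo (-N) N, HasDerivAt u (v (u t)) t := by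
    intro N
    by_cases hN : 0 < N
    · have hPL : IsPicardLindelof (fun _ => v) (tmin := -N) (tmax := N)
          ⟨0, by simp [hN.le]⟩ x₀ (L * N.toNNReal) 0 L K := by
        refine .of_time_independent (fun x _ => hL x) hK.lipschitzOnWith ?_
        simp [hN.le]
      obtain ⟨u, hu0, hu⟩ := hPL.exists_eq_forall_mem_Icc_hasDerivWithinAt₀
      exact ⟨u, fun _ => ⟨hu0, fun t ht =>
        (hu t (Ioo_subset_Icc_self ht)).hasDerivAt (Icc_mem_nhds ht.1 ht.2)⟩⟩
    · exact ⟨0, fun h => absurd h hN⟩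
  choose u hu using hloc
  have hagree : ∀ {M N t : ℝ}, |t| < M → |t| < N → u M t = u N t := by
    intro M N t hM hN
    have hM0 := (abs_nonneg t).trans_lt hM
    have hN0 := (abs_nonneg t).trans_lt hN
    have hmin : 0 < min M N := lt_min hM0 hN0
    refine ODE_solution_unique_of_mem_Ioo (v := fun _ => v) (s := fun _ => univ) (K := K)
      (a := -min M N) (b := min M N) (t₀ := 0) (fun _ _ => hK.lipschitzOnWith) (by simpa using hmin)
      (fun s hs => ⟨(hu M hM0).2 s ?_, mem_univ _⟩) (fun s hs => ⟨(hu N hN0).2 s ?_, mem_univ _⟩)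
      ((hu M hM0).1.trans (hu N hN0).1.symm) (abs_lt.1 (lt_min hM hN))
    · exact abs_lt.1 ((abs_lt.2 hs).trans_le (min_le_left _ _))
    · exact abs_lt.1 ((abs_lt.2 hs).trans_le (min_le_right _ _))
  refine ⟨fun t => u (|t| + 1) t, (hu _ (by positivity)).1, fun t => ?_⟩
  refine ((hu (|t| + 1) (by positivity)).2 t (abs_lt.1 (lt_add_one _))).congr_of_eventuallyEq ?_
  filter_upwards [(continuous_abs.continuousAt (x := t)).eventually_lt_const (lt_add_one |t|)]
    with s hs
  exact hagree (lt_add_one _) hs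

end GlobalODE

/-! ### Global existence and uniqueness for the Toda hierarchy -/

section Toda

open Set Metric NNReal

variable (r : ℕ) (c : ℕ → ℝ)

theorem contDiff_todaPoly : ContDiff ℝ (⊤ : ℕ∞) fun u => todaPoly r c (jacobi u) :=
  ContDiff.sum fun l _ => (jacobi.contDiff.pow l).const_smul _

theorem contDiff_todaFlux : ContDiff ℝ (⊤ : ℕ∞) (todaFlux r c) :=
  ContDiff.const_smul 2 (contDiff_fst.mul
    ((shift 1).contDiff.comp ((diagonal (-1)).contDiff.comp (contDiff_todaPoly r c))))

theorem contDiff_todaField : ContDiff ℝ (⊤ : ℕ∞) (todaField r c) := by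
  have hd := (diagonal 0).contDiff.comp (contDiff_todaPoly r c)
  exact (contDiff_fst.mul (((shift 1).contDiff.comp hd).sub hd)).prodMk
    ((contDiff_todaFlux r c).sub ((shift (-1)).contDiff.comp (contDiff_todaFlux r c)))

theorem lipschitzOnBounded_todaPoly : LipschitzOnBounded fun u => todaPoly r c (jacobi u) :=
  .sum _ fun l => .const_smul _ (.pow (.clm jacobi) l)

theorem lipschitzOnBounded_todaFlux : LipschitzOnBounded (todaFlux r c) :=
  .const_smul 2 (.mul (.clm (ContinuousLinearMap.fst ℝ LinfZ LinfZ))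
    (.clm_comp (shift 1) (.clm_comp (diagonal (-1)) (lipschitzOnBounded_todaPoly r c))))

theorem lipschitzOnBounded_todaField : LipschitzOnBounded (todaField r c) := by
  have hd := (lipschitzOnBounded_todaPoly r c).clm_comp (diagonal 0)
  exact (LipschitzOnBounded.mul (.clm (ContinuousLinearMap.fst ℝ LinfZ LinfZ))
    ((hd.clm_comp (shift 1)).sub hd)).prodMk
      ((lipschitzOnBounded_todaFlux r c).sub ((lipschitzOnBounded_todaFlux r c).clm_comp _))

variable {r c}

/-- A priori bound along the Toda flow, possibly with a state-dependent rescaling. -/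
theorem norm_le_of_hasDerivAt_todaField {u : ℝ → LinfZ × LinfZ} {θ : LinfZ × LinfZ → ℝ}
    (hu : ∀ t, HasDerivAt u (todaField r c (θ (u t) • u t)) t) (t : ℝ) :
    ‖u t‖ ≤ ‖jacobi (u 0)‖ := by
  refine (norm_le_norm_jacobi _).trans (norm_le_of_lax (A := fun t => jacobi (u t))
    (fun t => ⟨θ (u t) • laxOp r c (θ (u t) • u t), fun x => ?_, ?_⟩) t)
  · change inner ℝ x (θ (u t) • laxOp r c (θ (u t) • u t) x) = 0
    rw [inner_smul_right, inner_laxOp_self, mul_zero]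
  · refine (jacobi.hasFDerivAt.comp_hasDerivAt t (hu t)).congr_deriv ?_
    rw [jacobi_todaField, map_smul jacobi, mul_smul_comm, smul_mul_assoc, smul_mul_assoc,
      mul_smul_comm]

theorem exists_hasDerivAt_todaField (r : ℕ) (c : ℕ → ℝ) (u₀ : LinfZ × LinfZ) :
    ∃ u : ℝ → LinfZ × LinfZ, u 0 = u₀ ∧ ∀ t, HasDerivAt u (todaField r c (u t)) t := by
  set R : ℝ := ‖jacobi u₀‖ + 1
  have hR : 0 < R := by positivity
  obtain ⟨K, hK, hlip⟩ := lipschitzOnBounded_todaField r c R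
  obtain ⟨M, hM, hbdd⟩ := (lipschitzOnBounded_todaField r c).exists_norm_le R
  obtain ⟨u, hu0, hu⟩ := exists_hasDerivAt_of_lipschitz_of_bounded
    (v := fun x => todaField r c (radialFactor R x • x)) (K := (K * 2).toNNReal) (L := M.toNNReal)
    (LipschitzWith.of_dist_le_mul fun x y => by
      rw [dist_eq_norm, dist_eq_norm, Real.coe_toNNReal _ (by positivity), mul_assoc]
      refine (hlip _ _ (norm_radialFactor_smul_le hR x) (norm_radialFactor_smul_le hR y)).trans ?_
      gcongr
      exact norm_radialFactor_smul_sub_le hR x y)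
    (fun x => by
      rw [Real.coe_toNNReal _ hM]
      exact hbdd _ (norm_radialFactor_smul_le hR x)) u₀
  refine ⟨u, hu0, fun t => ?_⟩
  have hle : ‖u t‖ ≤ R := by
    have := norm_le_of_hasDerivAt_todaField hu t
    rw [hu0] at this
    exact this.trans (lt_add_one _).le
  simpa only [radialFactor_eq_one hR hle, one_smul] using hu t

theorem eq_of_hasDerivAt_todaField {u v : ℝ → LinfZ × LinfZ}
    (hu : ∀ t, HasDerivAt u (todaField r c (u t)) t)
    (hv : ∀ t, HasDerivAt v (todaField r c (v t)) t) (h0 : u 0 = v 0) : u = v := by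
  obtain ⟨K, hK, hlip⟩ := lipschitzOnBounded_todaField r c ‖jacobi (u 0)‖
  have hbdd : ∀ {w : ℝ → LinfZ × LinfZ}, (∀ t, HasDerivAt w (todaField r c (w t)) t) →
      w 0 = u 0 → ∀ t, w t ∈ closedBall 0 ‖jacobi (u 0)‖ := by
    intro w hw hw0 t
    rw [mem_closedBall_zero_iff, ← hw0]
    exact norm_le_of_hasDerivAt_todaField (θ := fun _ => 1) (by simpa only [one_smul] using hw) t
  refine ODE_solution_unique_univ (v := fun _ => todaField r c)
    (s := fun _ => closedBall 0 ‖jacobi (u 0)‖) (K := K.toNNReal) (t₀ := 0)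
    (fun _ => LipschitzOnWith.of_dist_le_mul fun x hx y hy => ?_)
    (fun t => ⟨hu t, hbdd hu rfl t⟩) (fun t => ⟨hv t, hbdd hv h0.symm t⟩) h0
  rw [dist_eq_norm, dist_eq_norm, Real.coe_toNNReal _ hK]
  exact hlip x y (mem_closedBall_zero_iff.1 hx) (mem_closedBall_zero_iff.1 hy)

theorem todaField_fst_eq (u : LinfZ × LinfZ) (n : ℤ) :
    (todaField r c u).1 n
      = u.1 n * (gCoeff c (jacobi u) (r + 1) (n + 1) - gCoeff c (jacobi u) (r + 1) n) := by
  rw [gCoeff_eq, gCoeff_eq, todaField_fst_apply]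

theorem todaField_snd_eq (u : LinfZ × LinfZ) (n : ℤ) :
    (todaField r c u).2 n
      = hCoeff (fun m => u.1 m) c (jacobi u) (r + 1) n
        - hCoeff (fun m => u.1 m) c (jacobi u) (r + 1) (n - 1) := by
  rw [hCoeff_eq, hCoeff_eq, todaField_snd_apply, sub_add_cancel]
  ring

theorem HasDerivAt.linfZ_fst_apply {u : ℝ → LinfZ × LinfZ} {u' : LinfZ × LinfZ} {t : ℝ}
    (h : HasDerivAt u u' t) (n : ℤ) : HasDerivAt (fun s => (u s).1 n) (u'.1 n) t :=
  (evalLinf n ∘L ContinuousLinearMap.fst ℝ LinfZ LinfZ).hasFDerivAt.comp_hasDerivAt t h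

theorem HasDerivAt.linfZ_snd_apply {u : ℝ → LinfZ × LinfZ} {u' : LinfZ × LinfZ} {t : ℝ}
    (h : HasDerivAt u u' t) (n : ℤ) : HasDerivAt (fun s => (u s).2 n) (u'.2 n) t :=
  (evalLinf n ∘L ContinuousLinearMap.snd ℝ LinfZ LinfZ).hasFDerivAt.comp_hasDerivAt t h

theorem isTodaSolution_of_hasDerivAt {u : ℝ → LinfZ × LinfZ}
    (hu : ∀ t, HasDerivAt u (todaField r c (u t)) t) : IsTodaSolution r c u := fun t =>
  ⟨jacobi (u t), (isJacobiOp_iff _ _).2 rfl, fun n =>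
    ⟨todaField_fst_eq (u t) n ▸ (hu t).linfZ_fst_apply n,
      todaField_snd_eq (u t) n ▸ (hu t).linfZ_snd_apply n⟩⟩

theorem IsTodaSolution.hasDerivAt {u : ℝ → LinfZ × LinfZ} (hu : IsTodaSolution r c u)
    (hd : Differentiable ℝ u) (t : ℝ) : HasDerivAt u (todaField r c (u t)) t := by
  obtain ⟨H, hH, h⟩ := hu t
  obtain rfl := (isJacobiOp_iff _ _).1 hH
  have ht := (hd t).hasDerivAt
  refine ht.congr_deriv (Prod.ext (lp.ext (funext fun n => ?_)) (lp.ext (funext fun n => ?_)))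
  · rw [todaField_fst_eq]
    exact (ht.linfZ_fst_apply n).unique (h n).1
  · rw [todaField_snd_eq]
    exact (ht.linfZ_snd_apply n).unique (h n).2

end Toda

/-- For every `(a₀, b₀) ∈ ℓ∞(ℤ,ℝ) ⊕ ℓ∞(ℤ,ℝ)` there is a unique
integral curve `t ↦ (a(t), b(t))` of `TL_r`, defined for all `t ∈ ℝ`, which is `C^∞`
as a map from `ℝ` into `ℓ∞(ℤ,ℝ) ⊕ ℓ∞(ℤ,ℝ)` and satisfies `(a(0), b(0)) = (a₀, b₀)`. -/
theorem toda_exists_unique_solution (r : ℕ) (c : ℕ → ℝ) (hc0 : c 0 = 1)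
    (hc : ∀ j : ℕ, r < j → c j = 0) (a0 b0 : LinfZ) :
    ∃! u : ℝ → LinfZ × LinfZ,
      ContDiff ℝ (⊤ : ℕ∞) u ∧ IsTodaSolution r c u ∧ u 0 = (a0, b0) := by
  obtain ⟨u, hu0, hu⟩ := exists_hasDerivAt_todaField r c (a0, b0)
  refine ⟨u, ⟨contDiff_of_hasDerivAt (contDiff_todaField r c) hu,
    isTodaSolution_of_hasDerivAt hu, hu0⟩, ?_⟩
  rintro v ⟨hv, hvs, hv0⟩
  exact eq_of_hasDerivAt_todaField (hvs.hasDerivAt (hv.differentiable (by simp))) hu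
    (hv0.trans hu0.symm)
end
end

section
/- Suppose (a(t), b(t)) and (ā(t), b̄(t)) are two bounded solutions of the r-th Toda lattice equation TL_r (i.e., both curves take values in ℓ∞(ℤ,ℝ) ⊕ ℓ∞(ℤ,ℝ)), and let w : ℤ → (0,∞) be a weight satisfying sup_{n∈ℤ} ( w(n+1)/w(n) + w(n)/w(n+1) ) < ∞. If for one time t₀ ∈ ℝ the weighted sum Σ_{n∈ℤ} w(n) ( |a(n,t₀) − ā(n,t₀)| + |b(n,t₀) − b̄(n,t₀)| ) is finite, then for every t ∈ ℝ the sum Σ_{n∈ℤ} w(n) ( |a(n,t) − ā(n,t)| + |b(n,t) − b̄(n,t)| ) is finite. -/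
noncomputable section
open scoped ENNReal

/-- `x` and `y` are bounded by `K`, and their distance is at most `K * e`. -/
def CloseBy (K e x y : ℝ) : Prop :=
  |x| ≤ K ∧ |y| ≤ K ∧ |x - y| ≤ K * e

namespace CloseBy

variable {K L e e' Q x y x' y' : ℝ}

lemma nonneg (h : CloseBy K e x y) : 0 ≤ K := (abs_nonneg x).trans h.1

lemma const (c : ℝ) (he : 0 ≤ e) : CloseBy |c| e c c :=
  ⟨le_rfl, le_rfl, by simpa using mul_nonneg (abs_nonneg c) he⟩

lemma add (h : CloseBy K e x y) (h' : CloseBy L e x' y') :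
    CloseBy (K + L) e (x + x') (y + y') := by
  refine ⟨(abs_add_le _ _).trans (add_le_add h.1 h'.1),
    (abs_add_le _ _).trans (add_le_add h.2.1 h'.2.1), ?_⟩
  rw [add_sub_add_comm, add_mul]
  exact (abs_add_le _ _).trans (add_le_add h.2.2 h'.2.2)

lemma neg (h : CloseBy K e x y) : CloseBy K e (-x) (-y) := by
  refine ⟨by simpa using h.1, by simpa using h.2.1, ?_⟩
  rw [neg_sub_neg, abs_sub_comm]
  exact h.2.2

lemma sub (h : CloseBy K e x y) (h' : CloseBy L e x' y') :
    CloseBy (K + L) e (x - x') (y - y') := by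
  simpa only [sub_eq_add_neg] using h.add h'.neg

lemma mul (h : CloseBy K e x y) (h' : CloseBy L e x' y') :
    CloseBy (2 * (K * L)) e (x * x') (y * y') := by
  have hK := h.nonneg
  have hL := h'.nonneg
  have hKL : 0 ≤ K * L := mul_nonneg hK hL
  have h1 : |x * x'| ≤ K * L := by
    rw [abs_mul]; exact mul_le_mul h.1 h'.1 (abs_nonneg _) hK
  have h2 : |y * y'| ≤ K * L := by
    rw [abs_mul]; exact mul_le_mul h.2.1 h'.2.1 (abs_nonneg _) hK
  refine ⟨by linarith, by linarith, ?_⟩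
  calc |x * x' - y * y'| = |x * (x' - y') + (x - y) * y'| := by congr 1; ring
    _ ≤ |x| * |x' - y'| + |x - y| * |y'| := by
      simpa only [abs_mul] using abs_add_le (x * (x' - y')) ((x - y) * y')
    _ ≤ K * (L * e) + K * e * L := by
      gcongr
      · exact h.1
      · exact h'.2.2
      · exact (abs_nonneg _).trans h.2.2
      · exact h.2.2
      · exact h'.2.1
    _ = 2 * (K * L) * e := by ring

lemma mono (h : CloseBy K e x y) (hQ : 1 ≤ Q) (he : e ≤ Q * e') : CloseBy (K * Q) e' x y := by
  have hK := h.nonneg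
  have hKQ : K ≤ K * Q := le_mul_of_one_le_right hK hQ
  refine ⟨h.1.trans hKQ, h.2.1.trans hKQ, h.2.2.trans ?_⟩
  rw [mul_assoc]
  gcongr

lemma exists_sum {α : Type*} {ι : Type*} (s : Finset ι) (E : α → ℝ) (X Y : ι → α → ℝ)
    (hE : ∀ p, 0 ≤ E p) (h : ∀ i, ∃ K, ∀ p, CloseBy K (E p) (X i p) (Y i p)) :
    ∃ K, ∀ p, CloseBy K (E p) (∑ i ∈ s, X i p) (∑ i ∈ s, Y i p) := by
  classical
  induction s using Finset.induction_on with
  | empty => exact ⟨|0|, fun p => by simpa using CloseBy.const 0 (hE p)⟩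
  | insert i s hi ih =>
    obtain ⟨K, hK⟩ := ih
    obtain ⟨L, hL⟩ := h i
    refine ⟨L + K, fun p => ?_⟩
    simp only [Finset.sum_insert hi]
    exact (hL p).add (hK p)

end CloseBy

/-- A pair of Jacobi operators `H` and `H'` with coefficients `a, b` and `a', b'` that
are bounded by `B` and differ at site `n` by at most `B * P n`, where `P` changes by a factor of at
most `Q` between neighbouring sites. -/
structure JacobiPair (B Q : ℝ) where
  P : ℤ → ℝ
  a : ℤ → ℝ
  b : ℤ → ℝ
  a' : ℤ → ℝ
  b' : ℤ → ℝ
  H : L2Z →L[ℝ] L2Z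
  H' : L2Z →L[ℝ] L2Z
  nonneg : ∀ n, 0 ≤ P n
  le_succ : ∀ n, P n ≤ Q * P (n + 1)
  succ_le : ∀ n, P (n + 1) ≤ Q * P n
  jacobi : IsJacobiOp a b H
  jacobi' : IsJacobiOp a' b' H'
  close_a : ∀ n, CloseBy B (P n) (a n) (a' n)
  close_b : ∀ n, CloseBy B (P n) (b n) (b' n)

namespace JacobiPair

variable {B Q : ℝ}

lemma abs_deltaBasis_apply_le (m n : ℤ) : |deltaBasis n m| ≤ 1 := by
  have h := lp.norm_apply_le_norm (p := 2) (by norm_num) (deltaBasis n) m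
  rw [deltaBasis, lp.norm_single (by norm_num)] at h
  simpa [deltaBasis] using h

lemma pred_le (J : JacobiPair B Q) (n : ℤ) : J.P (n - 1) ≤ Q * J.P n := by
  simpa using J.le_succ (n - 1)

lemma exists_closeBy_pow (hQ : 1 ≤ Q) (l : ℕ) :
    ∃ K, ∀ (J : JacobiPair B Q) (m n : ℤ), CloseBy K (J.P m)
      ((J.H ^ l) (deltaBasis n) m) ((J.H' ^ l) (deltaBasis n) m) := by
  induction l with
  | zero =>
    refine ⟨1, fun J m n => ?_⟩
    have h := abs_deltaBasis_apply_le m n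
    exact ⟨by simpa using h, by simpa using h, by simpa using J.nonneg m⟩
  | succ l ih =>
    obtain ⟨K, hK⟩ := ih
    refine ⟨2 * (B * (K * Q)) + 2 * (B * Q * (K * Q)) + 2 * (B * K), fun J m n => ?_⟩
    rw [pow_succ', pow_succ', mul_apply_eq_comp, mul_apply_eq_comp,
      J.jacobi, J.jacobi']
    exact (((J.close_a m).mul ((hK J (m + 1) n).mono hQ (J.succ_le m))).add
      (((J.close_a (m - 1)).mono hQ (J.pred_le m)).mul
        ((hK J (m - 1) n).mono hQ (J.pred_le m)))).add
      ((J.close_b m).mul (hK J m n))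

lemma inner_deltaBasis (m : ℤ) (f : L2Z) : inner (𝕜 := ℝ) (deltaBasis m) f = f m := by
  simp [deltaBasis, lp.inner_single_left]

lemma exists_closeBy_sum (hQ : 1 ≤ Q) (c : ℕ → ℝ) (j : ℕ) :
    ∃ K, ∀ (J : JacobiPair B Q) (m n : ℤ), CloseBy K (J.P m)
      (∑ l ∈ Finset.range (j + 1), c (j - l) * inner (𝕜 := ℝ) (deltaBasis m)
        ((J.H ^ l) (deltaBasis n)))
      (∑ l ∈ Finset.range (j + 1), c (j - l) * inner (𝕜 := ℝ) (deltaBasis m)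
        ((J.H' ^ l) (deltaBasis n))) := by
  obtain ⟨K, hK⟩ := CloseBy.exists_sum (α := JacobiPair B Q × ℤ × ℤ) (Finset.range (j + 1))
    (fun p => p.1.P p.2.1)
    (fun l p => c (j - l) * inner (𝕜 := ℝ) (deltaBasis p.2.1) ((p.1.H ^ l) (deltaBasis p.2.2)))
    (fun l p => c (j - l) * inner (𝕜 := ℝ) (deltaBasis p.2.1) ((p.1.H' ^ l) (deltaBasis p.2.2)))
    (fun p => p.1.nonneg _) (fun l => by
      obtain ⟨K, hK⟩ := exists_closeBy_pow (B := B) hQ l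
      refine ⟨2 * (|c (j - l)| * K), fun p => ?_⟩
      simp only [inner_deltaBasis]
      exact (CloseBy.const _ (p.1.nonneg _)).mul (hK _ _ _))
  exact ⟨K, fun J m n => hK (J, m, n)⟩

/-- The right-hand sides of the Toda equations differ by at most a multiple of `P`. -/
lemma exists_toda_bound (hQ : 1 ≤ Q) (c : ℕ → ℝ) (j : ℕ) :
    ∃ K, ∀ (J : JacobiPair B Q) (n : ℤ),
      |J.a n * (gCoeff c J.H j (n + 1) - gCoeff c J.H j n)
        - J.a' n * (gCoeff c J.H' j (n + 1) - gCoeff c J.H' j n)| ≤ K * J.P n ∧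
      |(hCoeff J.a c J.H j n - hCoeff J.a c J.H j (n - 1))
        - (hCoeff J.a' c J.H' j n - hCoeff J.a' c J.H' j (n - 1))| ≤ K * J.P n := by
  obtain ⟨K, hK⟩ := exists_closeBy_sum (B := B) hQ c j
  have hg (J : JacobiPair B Q) (n : ℤ) :
      CloseBy K (J.P n) (gCoeff c J.H j n) (gCoeff c J.H' j n) := hK J n n
  obtain ⟨L, hh⟩ : ∃ L, ∀ (J : JacobiPair B Q) (n : ℤ),
      CloseBy L (J.P n) (hCoeff J.a c J.H j n) (hCoeff J.a' c J.H' j n) :=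
    ⟨_, fun J n => (((CloseBy.const 2 (J.nonneg n)).mul (J.close_a n)).mul
      ((hK J (n + 1) n).mono hQ (J.succ_le n))).add (CloseBy.const (c (j + 1)) (J.nonneg n))⟩
  refine ⟨max (2 * (B * (K * Q + K))) (L + L * Q), fun J n => ⟨?_, ?_⟩⟩
  · exact ((J.close_a n).mul (((hg J (n + 1)).mono hQ (J.succ_le n)).sub (hg J n))).2.2.trans
      (mul_le_mul_of_nonneg_right (le_max_left _ _) (J.nonneg n))
  · exact ((hh J n).sub ((hh J (n - 1)).mono hQ (J.pred_le n))).2.2.trans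
      (mul_le_mul_of_nonneg_right (le_max_right _ _) (J.nonneg n))

end JacobiPair

lemma norm_le_mul_exp_of_norm_deriv_le {E : Type*} [NormedAddCommGroup E] [NormedSpace ℝ E]
    {f f' : ℝ → E} {K t₀ t : ℝ} (hf : ∀ s, HasDerivAt f (f' s) s)
    (hK : ∀ s ∈ Set.uIcc t₀ t, ‖f' s‖ ≤ K * ‖f s‖) :
    ‖f t‖ ≤ ‖f t₀‖ * Real.exp (K * |t - t₀|) := by
  have forward {g g' : ℝ → E} {a b : ℝ} (hab : a ≤ b) (hg : ∀ s, HasDerivAt g (g' s) s)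
      (hK : ∀ s ∈ Set.Icc a b, ‖g' s‖ ≤ K * ‖g s‖) :
      ‖g b‖ ≤ ‖g a‖ * Real.exp (K * (b - a)) := by
    rw [← gronwallBound_ε0]
    exact norm_le_gronwallBound_of_norm_deriv_right_le
      (fun s _ => (hg s).continuousAt.continuousWithinAt) (fun s _ => (hg s).hasDerivWithinAt)
      le_rfl (fun s hs => by simpa using hK s (Set.Ico_subset_Icc_self hs)) b ⟨hab, le_rfl⟩
  rcases le_total t₀ t with h | h
  · rw [abs_of_nonneg (sub_nonneg.2 h)]
    exact forward h hf fun s hs => hK s (by rwa [Set.uIcc_of_le h])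
  · rw [abs_of_nonpos (sub_nonpos.2 h)]
    have := forward (g := fun s => f (-s)) (g' := fun s => -f' (-s)) (neg_le_neg h)
      (fun s => by simpa [Function.comp_def] using (hf (-s)).scomp s (hasDerivAt_neg s))
      (fun s hs => by
        rw [norm_neg]
        exact hK (-s) (by
          rw [Set.uIcc_of_ge h]
          exact ⟨by linarith [hs.2], by linarith [hs.1]⟩))
    simpa [sub_eq_add_neg, add_comm] using this

lemma summable_pow_natAbs {x : ℝ} (h0 : 0 ≤ x) (h1 : x < 1) :
    Summable fun k : ℤ => x ^ k.natAbs :=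
  .of_nat_of_neg (by simpa using summable_geometric_of_lt_one h0 h1)
    (by simpa using summable_geometric_of_lt_one h0 h1)

lemma weight_le_pow_mul {w : ℤ → ℝ} {C : ℝ} (hC : 0 ≤ C) (h1 : ∀ n, w (n + 1) ≤ C * w n)
    (h2 : ∀ n, w n ≤ C * w (n + 1)) (n k : ℤ) : w n ≤ C ^ k.natAbs * w (n + k) := by
  have forward (j : ℕ) : ∀ n, w n ≤ C ^ j * w (n + j) := by
    induction j with
    | zero => simp
    | succ j ih =>
      intro n
      calc w n ≤ C ^ j * w (n + j) := ih n
        _ ≤ C ^ j * (C * w (n + j + 1)) := by gcongr; exact h2 _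
        _ = C ^ (j + 1) * w (n + (j + 1 : ℕ)) := by push_cast; rw [pow_succ, ← add_assoc]; ring
  have backward (j : ℕ) : ∀ n, w n ≤ C ^ j * w (n - j) := by
    induction j with
    | zero => simp
    | succ j ih =>
      intro n
      have h := h1 (n - j - 1)
      rw [sub_add_cancel] at h
      calc w n ≤ C ^ j * w (n - j) := ih n
        _ ≤ C ^ j * (C * w (n - j - 1)) := by gcongr
        _ = C ^ (j + 1) * w (n - (j + 1 : ℕ)) := by
          push_cast; rw [pow_succ, ← sub_sub]; ring
  rcases Int.natAbs_eq k with hk | hk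
  · have := forward k.natAbs n
    rwa [← hk] at this
  · have := backward k.natAbs n
    rwa [sub_eq_add_neg, ← hk] at this

/-- A sequence summable against a weight with bounded ratios has a majorant with bounded ratios
which is summable against the same weight. -/
lemma exists_slowly_varying_majorant {w d : ℤ → ℝ} {C : ℝ} (hw : ∀ n, 0 < w n) (hC : 1 ≤ C)
    (h1 : ∀ n, w (n + 1) ≤ C * w n) (h2 : ∀ n, w n ≤ C * w (n + 1)) (hd : ∀ n, 0 ≤ d n)
    (hwd : Summable fun n => w n * d n) :
    ∃ (p : ℤ → ℝ) (Q : ℝ), 1 ≤ Q ∧ (∀ n, d n ≤ p n) ∧ (∀ n, p n ≤ Q * p (n + 1)) ∧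
      (∀ n, p (n + 1) ≤ Q * p n) ∧ Summable fun n => w n * p n := by
  have hC0 : 0 < C := one_pos.trans_le hC
  set Q := 2 * C with hQdef
  have hQ : 1 ≤ Q := by linarith
  have hQ0 : 0 < Q := one_pos.trans_le hQ
  have hqC : Q⁻¹ * C = 1 / 2 := by rw [hQdef]; field_simp
  have hsum : Summable fun z : ℤ × ℤ => w z.1 * (Q⁻¹ ^ z.2.natAbs * d (z.1 + z.2)) := by
    have hgeo := hwd.mul_of_nonneg (summable_pow_natAbs (x := 1 / 2) (by norm_num) (by norm_num))
      (fun n => mul_nonneg (hw n).le (hd n)) (fun k => by positivity)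
    let σ : ℤ × ℤ ≃ ℤ × ℤ :=
      ⟨fun z => (z.1 + z.2, z.2), fun z => (z.1 - z.2, z.2), fun z => by simp, fun z => by simp⟩
    refine (σ.summable_iff.2 hgeo).of_nonneg_of_le (fun z => ?_) (fun z => ?_)
    · exact mul_nonneg (hw _).le (mul_nonneg (by positivity) (hd _))
    · have hz := weight_le_pow_mul hC0.le h1 h2 z.1 z.2
      have := hd (z.1 + z.2)
      calc w z.1 * (Q⁻¹ ^ z.2.natAbs * d (z.1 + z.2))
          ≤ C ^ z.2.natAbs * w (z.1 + z.2) * (Q⁻¹ ^ z.2.natAbs * d (z.1 + z.2)) := by gcongr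
        _ = w (z.1 + z.2) * d (z.1 + z.2) * (Q⁻¹ * C) ^ z.2.natAbs := by rw [mul_pow]; ring
        _ = _ := by rw [hqC]; rfl
  have hin (n : ℤ) : Summable fun k : ℤ => Q⁻¹ ^ k.natAbs * d (n + k) :=
    (summable_mul_left_iff (hw n).ne').1 (hsum.prod_factor n)
  have hpow (j k : ℤ) (hjk : j.natAbs ≤ k.natAbs + 1) : Q⁻¹ ^ k.natAbs ≤ Q * Q⁻¹ ^ j.natAbs := by
    calc Q⁻¹ ^ k.natAbs = Q * Q⁻¹ ^ (k.natAbs + 1) := by rw [pow_succ]; field_simp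
      _ ≤ Q * Q⁻¹ ^ j.natAbs := by
        gcongr ?_ * ?_
        exact pow_le_pow_of_le_one (by positivity) (inv_le_one_of_one_le₀ hQ) hjk
  refine ⟨fun n => ∑' k : ℤ, Q⁻¹ ^ k.natAbs * d (n + k), Q, hQ, fun n => ?_, fun n => ?_,
    fun n => ?_, ?_⟩
  · simpa using (hin n).le_tsum 0 fun k _ => mul_nonneg (by positivity) (hd _)
  · beta_reduce
    rw [← tsum_mul_left,
      ← (Equiv.addRight (1 : ℤ)).tsum_eq fun k => Q⁻¹ ^ k.natAbs * d (n + k)]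
    refine Summable.tsum_le_tsum (fun k => ?_) ((Equiv.addRight (1 : ℤ)).summable_iff.2 (hin n))
      ((hin (n + 1)).mul_left Q)
    simp only [Equiv.coe_addRight]
    rw [← mul_assoc, show n + (k + 1) = n + 1 + k by ring]
    exact mul_le_mul_of_nonneg_right (hpow _ _ (by omega)) (hd _)
  · rw [← tsum_mul_left,
      ← (Equiv.addRight (1 : ℤ)).tsum_eq fun k => Q * (Q⁻¹ ^ k.natAbs * d (n + k))]
    refine Summable.tsum_le_tsum (fun k => ?_) (hin (n + 1))
      ((Equiv.addRight (1 : ℤ)).summable_iff.2 ((hin n).mul_left Q))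
    simp only [Equiv.coe_addRight]
    rw [← mul_assoc, show n + (k + 1) = n + 1 + k by ring]
    exact mul_le_mul_of_nonneg_right (hpow _ _ (by omega)) (hd _)
  · simpa only [tsum_mul_left] using hsum.prod

section

variable {E F : Type*} [NormedAddCommGroup E] [NormedSpace ℝ E] [NormedAddCommGroup F]
  [NormedSpace ℝ F] {f : ℝ → E × F} {f' : E × F} {t : ℝ}

lemma hasDerivAt_fst (hf : HasDerivAt f f' t) : HasDerivAt (fun s => (f s).1) f'.1 t :=
  (ContinuousLinearMap.fst ℝ E F).hasFDerivAt.comp_hasDerivAt t hf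

lemma hasDerivAt_snd (hf : HasDerivAt f f' t) : HasDerivAt (fun s => (f s).2) f'.2 t :=
  (ContinuousLinearMap.snd ℝ E F).hasFDerivAt.comp_hasDerivAt t hf

end

lemma hasDerivAt_linf_apply {f : ℝ → LinfZ} {f' : LinfZ} {t : ℝ} (hf : HasDerivAt f f' t) (n : ℤ) :
    HasDerivAt (fun s => f s n) (f' n) t :=
  (lp.evalCLM ℝ (fun _ : ℤ => ℝ) ∞ n).hasFDerivAt.comp_hasDerivAt t hf

/-- Two solutions whose difference is bounded by a slowly varying sequence at time `t₀` stay close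
in the same sense. The factor does not depend on the lower bound for that sequence. -/
lemma IsTodaSolution.exists_forall_abs_sub_le {r : ℕ} {c : ℕ → ℝ} {u v : ℝ → LinfZ × LinfZ}
    (hu' : Differentiable ℝ u) (hv' : Differentiable ℝ v)
    (hu : IsTodaSolution r c u) (hv : IsTodaSolution r c v) {Q : ℝ} (hQ : 1 ≤ Q) (t₀ t : ℝ) :
    ∃ L, ∀ (P : ℤ → ℝ) (ε : ℝ), 0 < ε → (∀ n, ε ≤ P n) → (∀ n, P n ≤ Q * P (n + 1)) →
      (∀ n, P (n + 1) ≤ Q * P n) →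
      (∀ n, |(u t₀).1 n - (v t₀).1 n| ≤ P n) → (∀ n, |(u t₀).2 n - (v t₀).2 n| ≤ P n) →
      ∀ n, |(u t).1 n - (v t).1 n| ≤ L * P n ∧ |(u t).2 n - (v t).2 n| ≤ L * P n := by
  obtain ⟨B₁, hB₁⟩ := isCompact_uIcc.exists_bound_of_continuousOn (s := Set.uIcc t₀ t)
    hu'.continuous.continuousOn
  obtain ⟨B₂, hB₂⟩ := isCompact_uIcc.exists_bound_of_continuousOn (s := Set.uIcc t₀ t)
    hv'.continuous.continuousOn
  set B := max 1 (max B₁ B₂) with hB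
  have hB1 : 1 ≤ B := le_max_left _ _
  have hcoord (x : LinfZ × LinfZ) (hx : ‖x‖ ≤ B) (n : ℤ) : |x.1 n| ≤ B ∧ |x.2 n| ≤ B :=
    ⟨((lp.norm_apply_le_norm ENNReal.top_ne_zero x.1 n).trans (norm_fst_le x)).trans hx,
      ((lp.norm_apply_le_norm ENNReal.top_ne_zero x.2 n).trans (norm_snd_le x)).trans hx⟩
  have huB (s) (hs : s ∈ Set.uIcc t₀ t) :=
    hcoord (u s) ((hB₁ s hs).trans ((le_max_left _ _).trans (le_max_right _ _)))
  have hvB (s) (hs : s ∈ Set.uIcc t₀ t) :=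
    hcoord (v s) ((hB₂ s hs).trans ((le_max_right _ _).trans (le_max_right _ _)))
  obtain ⟨K, hK⟩ := JacobiPair.exists_toda_bound (B := B) hQ c (r + 1)
  refine ⟨Real.exp (|K| * |t - t₀|), fun P ε hε hP hP1 hP2 ha hb => ?_⟩
  have hPpos (n : ℤ) : 0 < P n := hε.trans_le (hP n)
  let g : LinfZ := ⟨fun n => (P n)⁻¹, memℓp_infty ⟨ε⁻¹, by
    rintro _ ⟨n, rfl⟩
    simpa [abs_of_pos (hPpos n)] using inv_anti₀ hε (hP n)⟩⟩
  let D : LinfZ × LinfZ → LinfZ × LinfZ := fun x => (g * x.1, g * x.2)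
  have hg (x : LinfZ) (n : ℤ) : ‖(g * x) n‖ = |x n| / P n := by
    rw [lp.infty_coeFn_mul, Pi.mul_apply, norm_mul, Real.norm_eq_abs, Real.norm_eq_abs,
      show g n = (P n)⁻¹ from rfl, abs_inv, abs_of_pos (hPpos n), inv_mul_eq_div]
  have hD_le {x : LinfZ × LinfZ} {s : ℝ} (hs : 0 ≤ s)
      (h : ∀ n, |x.1 n| ≤ s * P n ∧ |x.2 n| ≤ s * P n) : ‖D x‖ ≤ s := by
    refine norm_prod_le_iff.2 ⟨lp.norm_le_of_forall_le hs fun n => ?_,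
      lp.norm_le_of_forall_le hs fun n => ?_⟩ <;> rw [hg, div_le_iff₀ (hPpos n)]
    exacts [(h n).1, (h n).2]
  have hle_D (x : LinfZ × LinfZ) (n : ℤ) :
      |x.1 n| ≤ ‖D x‖ * P n ∧ |x.2 n| ≤ ‖D x‖ * P n := by
    rw [← div_le_iff₀ (hPpos n), ← div_le_iff₀ (hPpos n), ← hg, ← hg]
    exact ⟨(lp.norm_apply_le_norm ENNReal.top_ne_zero _ n).trans (norm_fst_le (D x)),
      (lp.norm_apply_le_norm ENNReal.top_ne_zero _ n).trans (norm_snd_le (D x))⟩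
  have hderiv (s : ℝ) :
      HasDerivAt (fun s => D (u s - v s)) (D (deriv u s - deriv v s)) s := by
    have h := (hu' s).hasDerivAt.sub (hv' s).hasDerivAt
    exact ((hasDerivAt_fst h).const_mul g).prodMk ((hasDerivAt_snd h).const_mul g)
  have hbound (s : ℝ) (hs : s ∈ Set.uIcc t₀ t) :
      ‖D (deriv u s - deriv v s)‖ ≤ |K| * ‖D (u s - v s)‖ := by
    refine hD_le (by positivity) fun n => ?_
    obtain ⟨H, hH, hHd⟩ := hu s
    obtain ⟨H', hH', hHd'⟩ := hv s
    have hclose (x y z : ℝ) (hz : |x - y| ≤ z) (hx : |x| ≤ B) (hy : |y| ≤ B) :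
        CloseBy B z x y :=
      ⟨hx, hy, hz.trans (le_mul_of_one_le_left ((abs_nonneg _).trans hz) hB1)⟩
    have hnorm := norm_nonneg (D (u s - v s))
    let J : JacobiPair B Q :=
      { P := fun n => ‖D (u s - v s)‖ * P n
        a := fun n => (u s).1 n
        b := fun n => (u s).2 n
        a' := fun n => (v s).1 n
        b' := fun n => (v s).2 n
        H := H
        H' := H'
        nonneg := fun n => mul_nonneg hnorm (hPpos n).le
        le_succ := fun n => by
          rw [mul_left_comm]; exact mul_le_mul_of_nonneg_left (hP1 n) hnorm
        succ_le := fun n => by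
          rw [mul_left_comm]; exact mul_le_mul_of_nonneg_left (hP2 n) hnorm
        jacobi := hH
        jacobi' := hH'
        close_a := fun n =>
          hclose _ _ _ (hle_D (u s - v s) n).1 (huB s hs n).1 (hvB s hs n).1
        close_b := fun n =>
          hclose _ _ _ (hle_D (u s - v s) n).2 (huB s hs n).2 (hvB s hs n).2 }
    have hKn : K * J.P n ≤ |K| * ‖D (u s - v s)‖ * P n := by
      rw [mul_assoc]
      exact mul_le_mul_of_nonneg_right (le_abs_self K) (J.nonneg n)
    have hdu := (hu' s).hasDerivAt
    have hdv := (hv' s).hasDerivAt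
    have hu1 := (hasDerivAt_linf_apply (hasDerivAt_fst hdu) n).unique (hHd n).1
    have hu2 := (hasDerivAt_linf_apply (hasDerivAt_snd hdu) n).unique (hHd n).2
    have hv1 := (hasDerivAt_linf_apply (hasDerivAt_fst hdv) n).unique (hHd' n).1
    have hv2 := (hasDerivAt_linf_apply (hasDerivAt_snd hdv) n).unique (hHd' n).2
    have h := hK J n
    refine ⟨le_trans ?_ (h.1.trans hKn), le_trans ?_ (h.2.trans hKn)⟩
    · change |(deriv u s).1 n - (deriv v s).1 n| ≤ _
      rw [hu1, hv1]
    · change |(deriv u s).2 n - (deriv v s).2 n| ≤ _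
      rw [hu2, hv2]
  have hinit : ‖D (u t₀ - v t₀)‖ ≤ 1 :=
    hD_le zero_le_one fun n => by rw [one_mul]; exact ⟨ha n, hb n⟩
  have hfinal : ‖D (u t - v t)‖ ≤ Real.exp (|K| * |t - t₀|) :=
    (norm_le_mul_exp_of_norm_deriv_le hderiv hbound).trans
      (mul_le_of_le_one_left (Real.exp_pos _).le hinit)
  intro n
  have := hle_D (u t - v t) n
  have hmul := mul_le_mul_of_nonneg_right hfinal (hPpos n).le
  exact ⟨this.1.trans hmul, this.2.trans hmul⟩

/-- If `(a, b)` and `(ā, b̄)` are two bounded solutions of `TL_r` and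
`w : ℤ → (0,∞)` is a weight with `sup_n (w (n+1)/w n + w n / w (n+1)) < ∞`, then
finiteness of `∑_n w n (|a(n,t) - ā(n,t)| + |b(n,t) - b̄(n,t)|)` at one time `t₀`
implies its finiteness for every time `t`. -/
theorem toda_weighted_closeness_persists (r : ℕ) (c : ℕ → ℝ) (hc0 : c 0 = 1)
    (hc : ∀ j : ℕ, r < j → c j = 0)
    (u v : ℝ → LinfZ × LinfZ)
    (hu' : Differentiable ℝ u) (hv' : Differentiable ℝ v)
    (hu : IsTodaSolution r c u) (hv : IsTodaSolution r c v)
    (w : ℤ → ℝ) (hw : ∀ n : ℤ, 0 < w n)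
    (hwb : ∃ C : ℝ, ∀ n : ℤ, w (n + 1) / w n + w n / w (n + 1) ≤ C)
    (t0 : ℝ)
    (h0 : Summable fun n : ℤ =>
      w n * (|(u t0).1 n - (v t0).1 n| + |(u t0).2 n - (v t0).2 n|)) :
    ∀ t : ℝ, Summable fun n : ℤ =>
      w n * (|(u t).1 n - (v t).1 n| + |(u t).2 n - (v t).2 n|) := by
  obtain ⟨C₀, hC₀⟩ := hwb
  set C := max 1 C₀
  have hratio (n : ℤ) : w (n + 1) ≤ C * w n ∧ w n ≤ C * w (n + 1) := by
    have h1 := div_pos (hw (n + 1)) (hw n)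
    have h2 := div_pos (hw n) (hw (n + 1))
    have hC := (hC₀ n).trans (le_max_right 1 C₀)
    exact ⟨(div_le_iff₀ (hw n)).1 (by linarith), (div_le_iff₀ (hw (n + 1))).1 (by linarith)⟩
  obtain ⟨p, Q, hQ, hdp, hp1, hp2, hwp⟩ := exists_slowly_varying_majorant hw (le_max_left 1 C₀)
    (fun n => (hratio n).1) (fun n => (hratio n).2) (fun n => by positivity) h0
  intro t
  obtain ⟨L, hL⟩ := hu.exists_forall_abs_sub_le hu' hv' hv hQ t0 t
  have hp0 (n : ℤ) : 0 ≤ p n := le_trans (by positivity) (hdp n)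
  have key (n : ℤ) : |(u t).1 n - (v t).1 n| + |(u t).2 n - (v t).2 n| ≤ 2 * L * p n := by
    have hε (ε : ℝ) (h : 0 < ε) :
        |(u t).1 n - (v t).1 n| + |(u t).2 n - (v t).2 n| ≤ 2 * L * (p n + ε) := by
      have hQε : ε ≤ Q * ε := le_mul_of_one_le_left h.le hQ
      have := hL (fun n => p n + ε) ε h (fun n => le_add_of_nonneg_left (hp0 n))
        (fun n => by linarith [hp1 n]) (fun n => by linarith [hp2 n])
        (fun n => by linarith [hdp n, abs_nonneg ((u t0).2 n - (v t0).2 n)])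
        (fun n => by linarith [hdp n, abs_nonneg ((u t0).1 n - (v t0).1 n)]) n
      linarith [this.1, this.2]
    have hlim : Filter.Tendsto (fun ε : ℝ => 2 * L * (p n + ε)) (nhdsWithin 0 (Set.Ioi 0))
        (nhds (2 * L * (p n + 0))) :=
      ((by fun_prop : Continuous fun ε : ℝ => 2 * L * (p n + ε)).tendsto 0).mono_left
        nhdsWithin_le_nhds
    rw [add_zero] at hlim
    exact ge_of_tendsto hlim (Filter.eventually_of_mem self_mem_nhdsWithin hε)
  refine (hwp.mul_left (2 * L)).of_nonneg_of_le
    (fun n => mul_nonneg (hw n).le (by positivity)) fun n => ?_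
  calc _ ≤ w n * (2 * L * p n) := mul_le_mul_of_nonneg_left (key n) (hw n).le
    _ = 2 * L * (w n * p n) := by ring
end
end

section
/- Let 𝓗 be a complex Hilbert space, let t ↦ H(t) be a continuously differentiable (in operator norm) family of bounded self-adjoint operators on 𝓗, and let t ↦ P(t) be a norm-continuous family of bounded skew-adjoint operators (P(t)* = −P(t)) such that the Lax equation (d/dt) H(t) = P(t) H(t) − H(t) P(t) holds for all t ∈ ℝ. Then for all s, t ∈ ℝ there exists a unitary operator U(t,s) on 𝓗 with H(t) = U(t,s) H(s) U(t,s)*; in particular, the spectrum σ(H(t)) is independent of t. -/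
open Set Metric Filter Topology
open scoped NNReal

/-- A linear differential equation `U' = P U` in a Banach algebra, with continuous coefficient `P`,
has a local solution with initial value `1`. -/
theorem exists_hasDerivAt_mul_of_continuous {A : Type*} [NormedRing A] [NormedAlgebra ℝ A]
    [CompleteSpace A] {P : ℝ → A} (hP : Continuous P) (t₀ : ℝ) :
    ∃ U : ℝ → A, U t₀ = 1 ∧ ∃ ε > 0, ∀ t ∈ ball t₀ ε, HasDerivAt U (P t * U t) t := by
  obtain ⟨δ, hδ, hPδ⟩ : ∃ δ > 0, ∀ t ∈ ball t₀ δ, ‖P t‖ < ‖P t₀‖ + 1 :=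
    eventually_nhds_iff_ball.1 (hP.norm.continuousAt.eventually_lt_const (lt_add_one _))
  set K : ℝ≥0 := ‖P t₀‖₊ + 1 with hK
  set L : ℝ≥0 := K * (1 + ‖(1 : A)‖₊) with hL
  have hLpos : (0 : ℝ) < L := by
    have : 0 < L := by positivity
    exact_mod_cast this
  set ε : ℝ := min (δ / 2) (L : ℝ)⁻¹ with hε
  have hεpos : 0 < ε := by positivity
  have hbound : ∀ t ∈ Icc (t₀ - ε) (t₀ + ε), ‖P t‖ ≤ K := by
    intro t ht
    rw [← Real.closedBall_eq_Icc] at ht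
    have hεδ : ε < δ := (min_le_left _ _).trans_lt (half_lt_self hδ)
    simpa [hK] using (hPδ t (closedBall_subset_ball hεδ ht)).le
  have hPL : IsPicardLindelof (fun t X ↦ P t * X) (tmin := t₀ - ε) (tmax := t₀ + ε)
      ⟨t₀, by simp [hεpos.le]⟩ (1 : A) 1 0 L K :=
    { lipschitzOnWith := fun t ht ↦ LipschitzOnWith.of_dist_le_mul fun X _ Y _ ↦ by
        rw [dist_eq_norm, dist_eq_norm, ← mul_sub]
        exact (norm_mul_le _ _).trans (by gcongr; exact hbound t ht)
      continuousOn := fun X _ ↦ (hP.mul continuous_const).continuousOn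
      norm_le := fun t ht X hX ↦ by
        have hX' : ‖X‖ ≤ 1 + ‖(1 : A)‖ := by
          have := norm_le_norm_add_norm_sub' X 1
          have := mem_closedBall_iff_norm.1 hX
          simp only [NNReal.coe_one] at this
          linarith
        calc ‖P t * X‖ ≤ ‖P t‖ * ‖X‖ := norm_mul_le _ _
          _ ≤ K * (1 + ‖(1 : A)‖) := by gcongr; exact hbound t ht
          _ = L := by simp [hL]
      mul_max_le := by
        have : (L : ℝ) * ε ≤ 1 := by
          calc (L : ℝ) * ε ≤ L * (L : ℝ)⁻¹ := by gcongr; exact min_le_right _ _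
            _ = 1 := mul_inv_cancel₀ hLpos.ne'
        simpa using this }
  obtain ⟨U, hU₀, hU⟩ := hPL.exists_eq_forall_mem_Icc_hasDerivWithinAt₀
  refine ⟨U, hU₀, ε, hεpos, fun t ht ↦ ?_⟩
  rw [Real.ball_eq_Ioo] at ht
  exact (hU t (Ioo_subset_Icc_self ht)).hasDerivAt (Icc_mem_nhds ht.1 ht.2)

/-- If `H` solves the Lax equation `H' = P H - H P` with skew-adjoint `P`, and `U' = P U` with
`U t₀ = 1`, then `U* H U` is constant. -/
theorem star_mul_mul_eq_of_lax {A : Type*} [NormedRing A] [StarRing A] [NormedAlgebra ℝ A]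
    [StarModule ℝ A] [ContinuousStar A] {H P U : ℝ → A} {t₀ ε : ℝ}
    (hP : ∀ t, star (P t) = -P t) (hH : ∀ t, HasDerivAt H (P t * H t - H t * P t) t)
    (hU₀ : U t₀ = 1) (hU : ∀ t ∈ ball t₀ ε, HasDerivAt U (P t * U t) t) :
    ∀ t ∈ ball t₀ ε, star (U t) * H t * U t = H t₀ := by
  have hderiv : ∀ t ∈ ball t₀ ε, HasDerivAt (fun t ↦ star (U t) * H t * U t) 0 t := by
    intro t ht
    refine (((hU t ht).star.mul (hH t)).mul (hU t ht)).congr_deriv ?_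
    rw [Pi.mul_apply, star_mul, hP]
    noncomm_ring
  intro t ht
  have hconst := isOpen_ball.is_const_of_deriv_eq_zero (convex_ball t₀ ε).isPreconnected
    (fun x hx ↦ (hderiv x hx).differentiableAt.differentiableWithinAt)
    (fun x hx ↦ (hderiv x hx).deriv) ht (mem_ball_self (pos_of_mem_ball ht))
  simpa [hU₀] using hconst

/-- Solutions of the Lax equation `H' = P H - H P` with continuous skew-adjoint `P` are locally
unitarily conjugate. -/
theorem eventually_exists_unitary_conj_of_lax {A : Type*} [NormedRing A] [StarRing A]
    [NormedAlgebra ℝ A] [StarModule ℝ A] [ContinuousStar A] [CompleteSpace A] {H P : ℝ → A}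
    (hPcont : Continuous P) (hP : ∀ t, star (P t) = -P t)
    (hH : ∀ t, HasDerivAt H (P t * H t - H t * P t) t) (t₀ : ℝ) :
    ∀ᶠ t in 𝓝 t₀, ∃ U ∈ unitary A, H t = U * H t₀ * star U := by
  obtain ⟨U, hU₀, ε, hε, hU⟩ := exists_hasDerivAt_mul_of_continuous hPcont t₀
  have hunit : ∀ᶠ t in 𝓝 t₀, IsUnit (U t) :=
    (hU t₀ (mem_ball_self hε)).continuousAt.eventually
      (Units.isOpen.mem_nhds (by simp [hU₀]))
  filter_upwards [hunit, ball_mem_nhds t₀ hε] with t hUt ht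
  have hstar : star (U t) * U t = 1 := by
    simpa using star_mul_mul_eq_of_lax (H := fun _ ↦ 1) hP
      (fun s ↦ by simpa using hasDerivAt_const s (1 : A)) hU₀ hU t ht
  have hmem : U t ∈ unitary A := hUt.mem_unitary_of_star_mul_self hstar
  have hmul : U t * star (U t) = 1 := Unitary.mul_star_self_of_mem hmem
  refine ⟨U t, hmem, ?_⟩
  rw [← star_mul_mul_eq_of_lax hP hH hU₀ hU t ht]
  simp only [← mul_assoc, hmul, one_mul]
  simp only [mul_assoc, hmul, mul_one]

/-- Solutions of the Lax equation `H' = P H - H P` with continuous skew-adjoint `P` are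
unitarily conjugate at any two times. -/
theorem exists_unitary_conj_of_lax {A : Type*} [NormedRing A] [StarRing A]
    [NormedAlgebra ℝ A] [StarModule ℝ A] [ContinuousStar A] [CompleteSpace A] {H P : ℝ → A}
    (hPcont : Continuous P) (hP : ∀ t, star (P t) = -P t)
    (hH : ∀ t, HasDerivAt H (P t * H t - H t * P t) t) (s t : ℝ) :
    ∃ U ∈ unitary A, H t = U * H s * star U := by
  refine isPreconnected_univ.induction₂ (fun s t ↦ ∃ U ∈ unitary A, H t = U * H s * star U)
    (fun s _ ↦ ?_) ?_ ?_ (mem_univ s) (mem_univ t)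
  · rw [nhdsWithin_univ]
    exact eventually_exists_unitary_conj_of_lax hPcont hP hH s
  · rintro x y z - - - ⟨U, hU, hUy⟩ ⟨V, hV, hVz⟩
    exact ⟨V * U, mul_mem hV hU, by rw [hVz, hUy, star_mul]; simp only [mul_assoc]⟩
  · rintro x y - - ⟨U, hU, hUy⟩
    have hU' : star U * U = 1 := Unitary.star_mul_self_of_mem hU
    refine ⟨star U, Unitary.star_mem hU, ?_⟩
    rw [hUy, star_star]
    simp only [← mul_assoc, hU', one_mul]
    simp only [mul_assoc, hU', mul_one]

/-- Let `𝓗` be a complex Hilbert space, `t ↦ H t` a continuously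
differentiable (in operator norm) family of bounded self-adjoint operators and
`t ↦ P t` a norm-continuous family of bounded skew-adjoint operators satisfying the
Lax equation `(d/dt) H t = P t * H t - H t * P t` for all `t`.  Then for all `s, t`
there is a unitary `U` with `H t = U * H s * U*`; in particular the spectrum of `H t`
is independent of `t`. -/
theorem lax_pair_unitary_equivalence {𝓗 : Type*} [NormedAddCommGroup 𝓗]
    [InnerProductSpace ℂ 𝓗] [CompleteSpace 𝓗]
    (H P : ℝ → 𝓗 →L[ℂ] 𝓗)
    (hH : ContDiff ℝ 1 H)
    (hHsa : ∀ t : ℝ, IsSelfAdjoint (H t))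
    (hPcont : Continuous P)
    (hPskew : ∀ t : ℝ, ContinuousLinearMap.adjoint (P t) = -(P t))
    (hLax : ∀ t : ℝ, deriv H t = P t * H t - H t * P t) :
    ∀ s t : ℝ, ∃ U : 𝓗 →L[ℂ] 𝓗, U ∈ unitary (𝓗 →L[ℂ] 𝓗) ∧
      H t = U * H s * star U ∧ spectrum ℂ (H t) = spectrum ℂ (H s) := by
  intro s t
  have hderiv : ∀ t, HasDerivAt H (P t * H t - H t * P t) t := fun t ↦
    hLax t ▸ (hH.differentiable one_ne_zero t).hasDerivAt
  obtain ⟨U, hU, hUt⟩ := exists_unitary_conj_of_lax hPcont hPskew hderiv s t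
  refine ⟨U, hU, hUt, ?_⟩
  rw [hUt]
  exact Unitary.spectrum_star_right_conjugate (U := ⟨U, hU⟩)
end

section
/- Let w be a complex number with |w| < 1 and let c : ℤ → ℂ be a sequence with ‖c‖_∞ := sup_{n∈ℤ} |c(n)| < ∞, ‖c‖_1 := Σ_{n=0}^{∞} |c(n)| < ∞ and ‖c‖_{1,1} := Σ_{n=1}^{∞} n |c(n)| < ∞. Then Σ_{n=1}^{∞} n | Σ_{m=0}^{∞} c(n−m) w^m | ≤ ‖c‖_{1,1}/(1 − |w|) + |w| ‖c‖_1/(1 − |w|)² + |w|² ‖c‖_∞/(1 − |w|)³, where all the series involved converge absolutely. -/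
/-- The Cauchy product of two nonnegative summable sequences sums to the
product of their sums. -/
theorem hasSum_cauchyProduct_of_nonneg {f g : ℕ → ℝ} (hf : ∀ n, 0 ≤ f n) (hg : ∀ n, 0 ≤ g n)
    (hfs : Summable f) (hgs : Summable g) :
    HasSum (fun n : ℕ => ∑ k ∈ Finset.range (n + 1), f k * g (n - k))
      ((∑' n, f n) * ∑' n, g n) :=
  hasSum_sum_range_mul_of_summable_norm
    (by simpa only [Real.norm_of_nonneg (hf _)] using hfs)
    (by simpa only [Real.norm_of_nonneg (hg _)] using hgs)

/-- Splitting the series `∑ c (n - m) wᵐ` at `m = n` and bounding the tail by a geometric series. -/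
theorem norm_tsum_shift_le {w : ℂ} (hw : ‖w‖ < 1) {c : ℤ → ℂ} {M : ℝ} (hM : ∀ n, ‖c n‖ ≤ M)
    {n : ℕ} (hs : Summable fun m : ℕ => ‖c ((n : ℤ) - (m : ℤ)) * w ^ m‖) :
    ‖∑' m : ℕ, c ((n : ℤ) - (m : ℤ)) * w ^ m‖ ≤
      ∑ m ∈ Finset.range (n + 1), ‖w‖ ^ m * ‖c ((n - m : ℕ) : ℤ)‖ +
        M * (‖w‖ / (1 - ‖w‖)) * ‖w‖ ^ n := by
  refine (norm_tsum_le_tsum_norm hs).trans ?_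
  rw [← hs.sum_add_tsum_nat_add (n + 1)]
  refine add_le_add (Finset.sum_le_sum fun m hm => ?_) ?_
  · have hmn : m ≤ n := Nat.lt_succ_iff.mp (Finset.mem_range.mp hm)
    rw [norm_mul, norm_pow, Nat.cast_sub hmn, mul_comm]
  · have hg : HasSum (fun m : ℕ => M * ‖w‖ ^ (n + 1) * ‖w‖ ^ m)
        (M * ‖w‖ ^ (n + 1) * (1 - ‖w‖)⁻¹) :=
      (hasSum_geometric_of_lt_one (norm_nonneg w) hw).mul_left _
    have hle := ((summable_nat_add_iff (n + 1)).mpr hs).tsum_le_tsum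
      (fun m => ?_) hg.summable
    · refine hle.trans_eq ?_
      rw [hg.tsum_eq]
      ring
    · rw [norm_mul, norm_pow, pow_add, mul_assoc M, mul_comm (‖w‖ ^ (n + 1))]
      exact mul_le_mul_of_nonneg_right (hM _) (by positivity)


/-- Let `w` be a complex number with `|w| < 1` and `c : ℤ → ℂ` with
`‖c‖_∞ = sup_{n ∈ ℤ} |c n| < ∞`, `‖c‖₁ = ∑_{n=0}^∞ |c n| < ∞` and
`‖c‖₁,₁ = ∑_{n=1}^∞ n |c n| < ∞`.  Then all series involved converge absolutely and
`∑_{n=1}^∞ n |∑_{m=0}^∞ c (n-m) wᵐ|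
   ≤ ‖c‖₁,₁/(1-|w|) + |w| ‖c‖₁/(1-|w|)² + |w|² ‖c‖_∞/(1-|w|)³`. -/
theorem weighted_sum_reversed_shift_estimate (w : ℂ) (hw : ‖w‖ < 1) (c : ℤ → ℂ)
    (hbdd : BddAbove (Set.range fun n : ℤ => ‖c n‖))
    (h1 : Summable fun n : ℕ => ‖c (n : ℤ)‖)
    (h11 : Summable fun n : ℕ => (n : ℝ) * ‖c (n : ℤ)‖) :
    (∀ n : ℤ, Summable fun m : ℕ => ‖c (n - (m : ℤ)) * w ^ m‖) ∧
    Summable (fun n : ℕ => (n : ℝ) * ‖∑' m : ℕ, c ((n : ℤ) - (m : ℤ)) * w ^ m‖) ∧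
    ∑' n : ℕ, (n : ℝ) * ‖∑' m : ℕ, c ((n : ℤ) - (m : ℤ)) * w ^ m‖ ≤
      (∑' n : ℕ, (n : ℝ) * ‖c (n : ℤ)‖) / (1 - ‖w‖) +
        ‖w‖ * (∑' n : ℕ, ‖c (n : ℤ)‖) / (1 - ‖w‖) ^ 2 +
        ‖w‖ ^ 2 * (⨆ n : ℤ, ‖c n‖) / (1 - ‖w‖) ^ 3 := by
  have hM : ∀ n, ‖c n‖ ≤ ⨆ n : ℤ, ‖c n‖ := fun n => le_ciSup hbdd n
  set M := ⨆ n : ℤ, ‖c n‖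
  have hgeo := hasSum_geometric_of_lt_one (norm_nonneg w) hw
  have hgeo' : HasSum (fun n : ℕ => (n : ℝ) * ‖w‖ ^ n) (‖w‖ / (1 - ‖w‖) ^ 2) :=
    hasSum_coe_mul_geometric_of_norm_lt_one (by rwa [norm_norm])
  have hs : ∀ n : ℤ, Summable fun m : ℕ => ‖c (n - (m : ℤ)) * w ^ m‖ := fun n =>
    Summable.of_nonneg_of_le (fun m => norm_nonneg _)
      (fun m => by
        rw [norm_mul, norm_pow]
        exact mul_le_mul_of_nonneg_right (hM _) (by positivity))
      (hgeo.summable.mul_left M)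
  have hA := hasSum_cauchyProduct_of_nonneg (fun n => by positivity) (fun n => by positivity)
    hgeo.summable h11
  have hB := hasSum_cauchyProduct_of_nonneg (fun n => by positivity) (fun n => by positivity)
    hgeo'.summable h1
  have hU := (hA.add hB).add (hgeo'.mul_left (M * (‖w‖ / (1 - ‖w‖))))
  have hle : ∀ n : ℕ, (n : ℝ) * ‖∑' m : ℕ, c ((n : ℤ) - (m : ℤ)) * w ^ m‖ ≤ _ := fun n =>
    (mul_le_mul_of_nonneg_left (norm_tsum_shift_le hw hM (hs n)) n.cast_nonneg).trans_eq
      (show _ = (∑ k ∈ Finset.range (n + 1),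
            ‖w‖ ^ k * (((n - k : ℕ) : ℝ) * ‖c ((n - k : ℕ) : ℤ)‖) +
          ∑ k ∈ Finset.range (n + 1), ((k : ℝ) * ‖w‖ ^ k) * ‖c ((n - k : ℕ) : ℤ)‖) +
          M * (‖w‖ / (1 - ‖w‖)) * ((n : ℝ) * ‖w‖ ^ n) by
        rw [mul_add, Finset.mul_sum, ← Finset.sum_add_distrib]
        congr 1
        · refine Finset.sum_congr rfl fun k hk => ?_
          have hkn : (n : ℝ) = ((n - k : ℕ) : ℝ) + k := by
            rw [← Nat.cast_add, Nat.sub_add_cancel (Nat.lt_succ_iff.mp (Finset.mem_range.mp hk))]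
          rw [hkn]
          ring
        · ring)
  have hsum := Summable.of_nonneg_of_le (fun n : ℕ => by positivity) hle hU.summable
  refine ⟨hs, hsum, (hsum.tsum_le_tsum hle hU.summable).trans_eq ?_⟩
  have hr : 1 - ‖w‖ ≠ 0 := (sub_pos.mpr hw).ne'
  rw [hU.tsum_eq, hgeo.tsum_eq, hgeo'.tsum_eq]
  field_simp
end

section
/- Let 0 < q < 1, let k be a nonnegative integer, and let c : ℤ → [0, ∞) be a sequence with sup_{n∈ℤ} c(n) < ∞ and Σ_{n=0}^{∞} (1 + n) c(n) < ∞. Then the doubly infinite sum Σ_{n=1}^{∞} n ( Σ_{m∈ℤ} q^{|n−m| + |n−m+k|} c(m) ) is finite. -/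
theorem summable_zpow_abs {q : ℝ} (hq0 : 0 < q) (hq1 : q < 1) :
    Summable fun j : ℤ => q ^ |j| := by
  have h : Summable fun n : ℕ => q ^ n := summable_geometric_of_lt_one hq0.le hq1
  apply Summable.of_nat_of_neg <;> simpa using h

theorem summable_one_add_abs_mul_zpow_abs {q : ℝ} (hq0 : 0 < q) (hq1 : q < 1) :
    Summable fun j : ℤ => (1 + |(j : ℝ)|) * q ^ |j| := by
  have h : Summable fun n : ℕ => (1 + (n : ℝ)) * q ^ n := by
    have h₁ := summable_pow_mul_geometric_of_norm_lt_one 1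
      (show ‖q‖ < 1 by rwa [Real.norm_of_nonneg hq0.le])
    simpa [add_mul] using (summable_geometric_of_lt_one hq0.le hq1).add h₁
  apply Summable.of_nat_of_neg <;> simpa using h

theorem zpow_abs_add_abs_le {q : ℝ} (hq0 : 0 < q) (hq1 : q < 1) (a b : ℤ) :
    q ^ (|a| + |b|) ≤ q ^ |a| :=
  zpow_le_zpow_right_of_le_one₀ hq0 hq1.le (by simp)

theorem summable_prod_natCast_mul_zpow_abs_sub {q : ℝ} (hq0 : 0 < q) (hq1 : q < 1)
    {c : ℤ → ℝ} (hpos : ∀ n : ℤ, 0 ≤ c n) {C : ℝ} (hC : ∀ n : ℤ, c n ≤ C)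
    (hsum : Summable fun n : ℕ => (1 + (n : ℝ)) * c (n : ℤ)) :
    Summable fun p : ℕ × ℤ => (p.1 : ℝ) * (q ^ |(p.1 : ℤ) - p.2| * c p.2) := by
  have hC0 : 0 ≤ C := (hpos 0).trans (hC 0)
  have hg := summable_one_add_abs_mul_zpow_abs hq0 hq1
  have hg0 (j : ℤ) : 0 ≤ (1 + |(j : ℝ)|) * q ^ |j| := by positivity
  let d : ℤ → ℝ := fun m => if 0 ≤ m then (1 + (m : ℝ)) * c m else 0
  have hd0 (m : ℤ) : 0 ≤ d m := by
    by_cases hm : 0 ≤ m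
    · have : (0 : ℝ) ≤ m := mod_cast hm
      simpa [d, hm] using mul_nonneg (by positivity) (hpos m)
    · simp [d, hm]
  have hd : Summable d := by
    apply Summable.of_nat_of_neg_add_one
    · simpa [d] using hsum
    · refine summable_zero.congr fun n => ?_
      have : ¬ (0 : ℤ) ≤ -((n : ℤ) + 1) := by omega
      simp only [d, if_neg this]
  have near : Summable fun p : ℕ × ℤ =>
      (1 + |(((p.1 : ℤ) - p.2 : ℤ) : ℝ)|) * q ^ |(p.1 : ℤ) - p.2| * d p.2 := by
    refine (hg.mul_of_nonneg hd hg0 hd0).comp_injective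
      (i := fun p : ℕ × ℤ => ((p.1 : ℤ) - p.2, p.2)) fun a b hab => ?_
    simp only [Prod.mk.injEq] at hab
    exact Prod.ext (by omega) hab.2
  have far : Summable fun p : ℕ × ℤ =>
      (1 + |((p.1 : ℤ) : ℝ)|) * q ^ |(p.1 : ℤ)| * (C * q ^ |p.2|) :=
    (hg.mul_of_nonneg ((summable_zpow_abs hq0 hq1).mul_left C) hg0
      fun m => by positivity).comp_injective
      (i := fun p : ℕ × ℤ => ((p.1 : ℤ), p.2)) fun a b hab => by
        simp only [Prod.mk.injEq] at hab
        exact Prod.ext (by omega) hab.2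
  refine Summable.of_nonneg_of_le
    (fun p => mul_nonneg (by positivity) (mul_nonneg (by positivity) (hpos _)))
    (fun p => ?_) (near.add far)
  obtain ⟨n, m⟩ := p
  dsimp only
  by_cases hm : 0 ≤ m
  · refine le_add_of_le_of_nonneg ?_ (by positivity)
    have hm' : (0 : ℝ) ≤ m := mod_cast hm
    have hn : (n : ℝ) ≤ (1 + |(((n : ℤ) - m : ℤ) : ℝ)|) * (1 + m) := by
      push_cast
      nlinarith [le_abs_self ((n : ℝ) - m), mul_nonneg (abs_nonneg ((n : ℝ) - m)) hm']
    have hw : 0 ≤ q ^ |(n : ℤ) - m| * c m := mul_nonneg (by positivity) (hpos m)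
    simp only [d, if_pos hm]
    linarith [mul_le_mul_of_nonneg_right hn hw]
  · refine le_add_of_nonneg_of_le (mul_nonneg (by positivity) (hd0 m)) ?_
    have habs : |(n : ℤ) - m| = |(n : ℤ)| + |m| := by
      rw [abs_of_neg (not_le.mp hm), abs_of_nonneg (by omega), abs_of_nonneg (by omega)]
      ring
    have hn : (n : ℝ) ≤ 1 + |((n : ℤ) : ℝ)| := by simp
    rw [habs, zpow_add₀ hq0.ne']
    calc (n : ℝ) * (q ^ |(n : ℤ)| * q ^ |m| * c m)
        ≤ (1 + |((n : ℤ) : ℝ)|) * (q ^ |(n : ℤ)| * q ^ |m| * C) := by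
          have := hC m
          have := hpos m
          gcongr
      _ = _ := by ring


/-- Let `0 < q < 1`, let `k` be a nonnegative integer and let
`c : ℤ → [0,∞)` be bounded with `∑_{n=0}^∞ (1+n) c n < ∞`.  Then the doubly infinite
sum `∑_{n=1}^∞ n (∑_{m ∈ ℤ} q^{|n-m| + |n-m+k|} c m)` is finite, i.e. every inner
series converges and the outer weighted series converges. -/
theorem doubly_infinite_weighted_sum_finite (q : ℝ) (hq0 : 0 < q) (hq1 : q < 1)
    (k : ℕ) (c : ℤ → ℝ) (hpos : ∀ n : ℤ, 0 ≤ c n)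
    (hbdd : ∃ C : ℝ, ∀ n : ℤ, c n ≤ C)
    (hsum : Summable fun n : ℕ => (1 + (n : ℝ)) * c (n : ℤ)) :
    (∀ n : ℤ, Summable fun m : ℤ => q ^ (|n - m| + |n - m + (k : ℤ)|) * c m) ∧
    Summable (fun n : ℕ =>
      (n : ℝ) * ∑' m : ℤ, q ^ (|(n : ℤ) - m| + |(n : ℤ) - m + (k : ℤ)|) * c m) := by
  obtain ⟨C, hC⟩ := hbdd
  have hterm (n m : ℤ) : 0 ≤ q ^ (|n - m| + |n - m + (k : ℤ)|) * c m :=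
    mul_nonneg (by positivity) (hpos m)
  refine ⟨fun n => ?_, ?_⟩
  · have hs : Summable fun m : ℤ => q ^ |n - m| :=
      (summable_zpow_abs hq0 hq1).comp_injective (i := fun m => n - m) sub_right_injective
    refine Summable.of_nonneg_of_le (hterm n) (fun m => ?_) (hs.mul_right C)
    exact mul_le_mul (zpow_abs_add_abs_le hq0 hq1 _ _) (hC m) (hpos m) (by positivity)
  · have h : Summable fun p : ℕ × ℤ =>
        (p.1 : ℝ) * (q ^ (|(p.1 : ℤ) - p.2| + |(p.1 : ℤ) - p.2 + (k : ℤ)|) * c p.2) := by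
      refine Summable.of_nonneg_of_le (fun p => mul_nonneg (by positivity) (hterm _ _))
        (fun p => ?_) (summable_prod_natCast_mul_zpow_abs_sub hq0 hq1 hpos hC hsum)
      exact mul_le_mul_of_nonneg_left
        (mul_le_mul_of_nonneg_right (zpow_abs_add_abs_le hq0 hq1 _ _) (hpos _)) (by positivity)
    simpa only [tsum_mul_left] using h.prod
end
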